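/- arXiv:math/0411070 — 7 statements merged into one kernel-verified Lean document; each statement's English description precedes it below -/
import Mathlib

section
/- The adjoint identity (relation (0606b) of the paper): for every finitely supported family B : (Fin n →₀ ℕ) → R and every A ∈ R, Σ_Λ (−1)^{|Λ|} · d_Λ(B^Λ · A) = Σ_Λ η(B)^Λ · d_Λ(A). -/
/-- Size `|Λ|` of a multi-index. -/
def msize {n : ℕ} (Λ : Fin n →₀ ℕ) : ℕ := ∑ i, Λ i

/-- Multi-index binomial coefficient `C(Λ, T) = ∏ λ, choose (Λ λ) (T λ)`. -/
def mchoose {n : ℕ} (Λ T : Fin n →₀ ℕ) : ℕ := ∏ i, (Λ i).choose (T i)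

/-- Iterated derivative `d_Λ = ∏ λ (d λ)^[Λ λ]` (well defined for commuting `d λ`). -/
def dIter {R : Type*} {n : ℕ} (d : Fin n → R → R) (Λ : Fin n →₀ ℕ) : R → R :=
  (List.finRange n).foldr (fun i acc => (d i)^[Λ i] ∘ acc) id

/-- The intertwining operator `η(B)^Λ = ∑_T (-1)^{|T+Λ|} C(T+Λ, T) d_T (B^{T+Λ})`. -/
noncomputable def etaOp {R : Type*} [CommRing R] {n : ℕ}
    (d : Fin n → R → R) (B : (Fin n →₀ ℕ) → R) (Λ : Fin n →₀ ℕ) : R :=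
  ∑ᶠ T : Fin n →₀ ℕ,
    (-1 : R) ^ msize (T + Λ) * (mchoose (T + Λ) T : R) * dIter d T (B (T + Λ))

/-- One-variable Leibniz rule for iterates. -/
lemma iter_leibniz {R : Type*} [CommRing R] (D : R →+ R)
    (hmul : ∀ a b, D (a * b) = a * D b + D a * b) (k : ℕ) (a b : R) :
    D^[k] (a * b) = ∑ j ∈ Finset.range (k + 1), (k.choose j) • (D^[j] a * D^[k - j] b) := by
  rw [← Finset.Nat.sum_antidiagonal_eq_sum_range_succ
    (fun i j => (k.choose i) • (D^[i] a * D^[j] b))]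
  induction k with
  | zero => simp
  | succ k ih =>
    rw [Function.iterate_succ_apply', ih, map_sum,
      Finset.sum_antidiagonal_choose_succ_nsmul (fun i j => D^[i] a * D^[j] b) k,
      ← Finset.sum_add_distrib]
    refine Finset.sum_congr rfl fun p hp => ?_
    have hp' := Finset.HasAntidiagonal.mem_antidiagonal.1 hp
    rw [map_nsmul, hmul, Nat.choose_symm_of_eq_add hp'.symm, ← smul_add,
      Function.iterate_succ_apply', Function.iterate_succ_apply']

/-- Iterated derivative along a list. -/
def dList {R : Type*} {n : ℕ} (d : Fin n → R → R) (l : List (Fin n)) (f : Fin n → ℕ) : R → R :=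
  l.foldr (fun i acc => (d i)^[f i] ∘ acc) id

lemma dList_cons {R : Type*} {n : ℕ} (d : Fin n → R → R) (i : Fin n) (l : List (Fin n))
    (f : Fin n → ℕ) (x : R) : dList d (i :: l) f x = (d i)^[f i] (dList d l f x) := rfl

lemma dList_congr {R : Type*} {n : ℕ} (d : Fin n → R → R) (l : List (Fin n))
    (f g : Fin n → ℕ) (h : ∀ i ∈ l, f i = g i) (x : R) : dList d l f x = dList d l g x := by
  induction l with
  | nil => rfl
  | cons i l ih =>
    rw [dList_cons, dList_cons, h i (by simp), ih fun j hj => h j (by simp [hj])]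

lemma iter_zero' {R : Type*} [CommRing R] (D : R →+ R) (k : ℕ) : D^[k] 0 = 0 := by
  induction k with
  | zero => rfl
  | succ k ih => rw [Function.iterate_succ_apply', ih, map_zero]

lemma iter_add' {R : Type*} [CommRing R] (D : R →+ R) (k : ℕ) (a b : R) :
    D^[k] (a + b) = D^[k] a + D^[k] b := by
  induction k with
  | zero => rfl
  | succ k ih => simp only [Function.iterate_succ_apply', ih, map_add]

lemma dList_zero {R : Type*} [CommRing R] {n : ℕ} (D : Fin n → R →+ R) (l : List (Fin n))
    (f : Fin n → ℕ) : dList (fun i => ⇑(D i)) l f 0 = 0 := by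
  induction l with
  | nil => rfl
  | cons i l ih => rw [dList_cons, ih, iter_zero']

/-- Box of multi-indices below `f`, supported on `l`. -/
def box {n : ℕ} (l : List (Fin n)) (f : Fin n → ℕ) : Finset (Fin n → ℕ) :=
  Fintype.piFinset fun i => if i ∈ l then Finset.range (f i + 1) else {0}

lemma sum_box_cons {M : Type*} [AddCommMonoid M] {n : ℕ} (i : Fin n) (l : List (Fin n))
    (hi : i ∉ l) (f : Fin n → ℕ) (F : (Fin n → ℕ) → M) :
    ∑ T ∈ box (i :: l) f, F T =
      ∑ T ∈ box l f, ∑ k ∈ Finset.range (f i + 1), F (Function.update T i k) := by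
  rw [← Finset.sum_product' (box l f) (Finset.range (f i + 1))
    (fun T k => F (Function.update T i k))]
  refine Finset.sum_nbij' (fun T => (Function.update T i 0, T i))
    (fun p => Function.update p.1 i p.2) ?_ ?_ ?_ ?_ ?_
  · intro T hT
    simp only [box, Fintype.mem_piFinset, Finset.mem_product] at hT ⊢
    refine ⟨fun j => ?_, by simpa using hT i⟩
    by_cases hj : j = i
    · subst hj; simp [hi]
    · simpa [hj] using hT j
  · rintro ⟨T, k⟩ hT
    simp only [box, Fintype.mem_piFinset, Finset.mem_product] at hT ⊢
    intro j
    by_cases hj : j = i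
    · subst hj; simpa using hT.2
    · simpa [hj] using hT.1 j
  · intro T hT
    simp
  · rintro ⟨T, k⟩ hT
    simp only [box, Fintype.mem_piFinset, Finset.mem_product] at hT
    have := hT.1 i
    simp only [hi, if_false, Finset.mem_singleton] at this
    simp [← this]
  · intro T hT
    simp

lemma dList_leibniz {R : Type*} [CommRing R] {n : ℕ} (D : Fin n → R →+ R)
    (hmul : ∀ i a b, D i (a * b) = a * D i b + D i a * b) (l : List (Fin n)) (hl : l.Nodup)
    (f : Fin n → ℕ) (a b : R) :
    dList (fun i => ⇑(D i)) l f (a * b) = ∑ T ∈ box l f,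
      (l.map fun i => (f i).choose (T i)).prod •
        (dList (fun i => ⇑(D i)) l T a * dList (fun i => ⇑(D i)) l (f - T) b) := by
  induction l with
  | nil =>
    have : box ([] : List (Fin n)) f = {0} := by
      ext T; simp [box, funext_iff]
    simp [this, dList]
  | cons i l ih =>
    obtain ⟨hi, hl⟩ := List.nodup_cons.1 hl
    rw [sum_box_cons i l hi, dList_cons, ih hl]
    let E : R →+ R := AddMonoidHom.mk' ((D i)^[f i]) (iter_add' (D i) (f i))
    change E _ = _
    rw [map_sum]
    refine Finset.sum_congr rfl fun T _ => ?_
    rw [map_nsmul]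
    change _ • (D i)^[f i] _ = _
    rw [iter_leibniz (D i) (hmul i), Finset.smul_sum]
    refine Finset.sum_congr rfl fun k _ => ?_
    have hne : ∀ j ∈ l, j ≠ i := fun j hj h => hi (h ▸ hj)
    have h1 : (l.map fun j => (f j).choose (Function.update T i k j)) =
        l.map fun j => (f j).choose (T j) :=
      List.map_congr_left fun j hj => by simp [hne j hj]
    rw [dList_cons, dList_cons, List.map_cons, List.prod_cons, h1,
      dList_congr _ l (Function.update T i k) T (fun j hj => by simp [hne j hj]),
      dList_congr _ l (f - Function.update T i k) (f - T) (fun j hj => by simp [hne j hj]),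
      smul_smul, mul_comm]
    simp

lemma dIter_leibniz {R : Type*} [CommRing R] {n : ℕ} (D : Fin n → R →+ R)
    (hmul : ∀ i a b, D i (a * b) = a * D i b + D i a * b)
    (M : Fin n →₀ ℕ) (a b : R) :
    dIter (fun i => ⇑(D i)) M (a * b) = ∑ p ∈ Finset.HasAntidiagonal.antidiagonal M,
      (mchoose M p.1 : R) *
        (dIter (fun i => ⇑(D i)) p.1 a * dIter (fun i => ⇑(D i)) p.2 b) := by
  have key := dList_leibniz D hmul (List.finRange n) (List.nodup_finRange n) M a b
  change dList _ _ M _ = _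
  rw [key]
  refine Finset.sum_nbij' (fun T => (Finsupp.equivFunOnFinite.symm T,
    M - Finsupp.equivFunOnFinite.symm T)) (fun p => ⇑p.1) ?_ ?_ ?_ ?_ ?_
  · intro T hT
    simp only [box, Fintype.mem_piFinset] at hT
    rw [Finset.HasAntidiagonal.mem_antidiagonal]
    ext j
    have := hT j
    simp at this
    simp
    omega
  · rintro ⟨T, U⟩ h
    rw [Finset.HasAntidiagonal.mem_antidiagonal] at h
    subst h
    simp only [box, Fintype.mem_piFinset]
    intro j
    simp
  · intro T hT
    simp
  · rintro ⟨T, U⟩ h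
    rw [Finset.HasAntidiagonal.mem_antidiagonal] at h
    subst h
    ext j <;> simp
  · intro T hT
    rw [nsmul_eq_mul]
    congr 2

/-- The adjoint identity (relation (0606b)):
`∑_Λ (-1)^{|Λ|} d_Λ (B^Λ * A) = ∑_Λ η(B)^Λ * d_Λ A`. -/
theorem adjoint_identity {R : Type*} [CommRing R] {n : ℕ} (hn : 1 ≤ n)
    (d : Fin n → R → R)
    (hadd : ∀ i a b, d i (a + b) = d i a + d i b)
    (hmul : ∀ i a b, d i (a * b) = a * d i b + d i a * b)
    (hcomm : ∀ i j, d i ∘ d j = d j ∘ d i)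
    (B : (Fin n →₀ ℕ) → R) (hB : (Function.support B).Finite) (A : R) :
    ∑ᶠ Λ : Fin n →₀ ℕ, (-1 : R) ^ msize Λ * dIter d Λ (B Λ * A)
      = ∑ᶠ Λ : Fin n →₀ ℕ, etaOp d B Λ * dIter d Λ A := by
  classical
  let D : Fin n → R →+ R := fun i => AddMonoidHom.mk' (d i) (hadd i)
  have hz : ∀ T, dIter d T 0 = 0 := fun T => dList_zero D (List.finRange n) T
  let g : (Fin n →₀ ℕ) × (Fin n →₀ ℕ) → R := fun p =>
    (-1 : R) ^ msize (p.2 + p.1) * (mchoose (p.2 + p.1) p.2 : R) *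
      dIter d p.2 (B (p.2 + p.1)) * dIter d p.1 A
  let S := hB.toFinset
  let K := S.biUnion Finset.HasAntidiagonal.antidiagonal
  have hK : ∀ p, p ∈ K ↔ B (p.1 + p.2) ≠ 0 := by
    intro p; simp [K, S]
  have hg : Function.support g ⊆ (K : Set _) := by
    intro p hp
    rw [Finset.mem_coe, hK]
    intro h
    apply hp
    simp only [g]
    rw [add_comm p.2 p.1, h, hz]
    simp
  have hR : ∑ᶠ Λ : Fin n →₀ ℕ, etaOp d B Λ * dIter d Λ A = ∑ p ∈ K, g p := by
    rw [← finsum_eq_sum_of_support_subset g hg,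
      finsum_curry g (K.finite_toSet.subset hg)]
    refine finsum_congr fun Λ => ?_
    rw [etaOp, finsum_mul']
    refine ((hB.preimage (f := fun T => T + Λ) (fun _ _ _ _ h => add_right_cancel h))).subset ?_
    intro T hT h
    apply hT
    simp only at h
    simp only
    rw [h, hz, mul_zero]
  rw [hR, finsum_eq_sum_of_support_subset (s := S)]
  · rw [← Finset.sum_fiberwise_of_maps_to (s := K) (t := S) (g := fun p => p.1 + p.2)
      (fun p hp => by simpa [S] using (hK p).1 hp)]
    refine Finset.sum_congr rfl fun M hM => ?_
    have hf : K.filter (fun p => p.1 + p.2 = M) = Finset.HasAntidiagonal.antidiagonal M := by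
      ext p
      rw [Finset.mem_filter, Finset.HasAntidiagonal.mem_antidiagonal, hK]
      refine ⟨fun h => h.2, fun h => ⟨?_, h⟩⟩
      rw [h]; simpa [S] using hM
    have hL := dIter_leibniz D hmul M (B M) A
    change dIter d M _ = _ at hL
    rw [hf, hL, Finset.mul_sum]
    refine Finset.sum_nbij' Prod.swap Prod.swap ?_ ?_ (fun _ _ => rfl) (fun _ _ => rfl) ?_
    · intro p hp
      rw [Finset.HasAntidiagonal.mem_antidiagonal] at hp ⊢
      rw [← hp]; exact add_comm _ _
    · intro p hp
      rw [Finset.HasAntidiagonal.mem_antidiagonal] at hp ⊢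
      rw [← hp]; exact add_comm _ _
    intro p hp
    rw [Finset.HasAntidiagonal.mem_antidiagonal] at hp
    change (-1 : R) ^ msize M * ((mchoose M p.1 : R) * (dIter d p.1 (B M) * dIter d p.2 A)) = _
    simp only [g, Prod.fst_swap, Prod.snd_swap]
    rw [hp]
    ring
  · intro M hM
    simp only [S, Set.Finite.coe_toFinset, Function.mem_support]
    intro h
    apply hM
    simp only
    rw [h, zero_mul, hz, mul_zero]
end

section
/- The operator η is an involution (relation (0606) of the paper): for every finitely supported family B : (Fin n →₀ ℕ) → R and every multi-index Λ, η(η(B))^Λ = B^Λ. -/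
/-- The iterated derivative as an additive endomorphism. -/
noncomputable def etaD {R : Type*} [CommRing R] {n : ℕ} (f : Fin n → AddMonoid.End R)
    (T : Fin n →₀ ℕ) : AddMonoid.End R :=
  ((List.finRange n).map (fun i => f i ^ T i)).prod

theorem dIter_eq_etaD {R : Type*} [CommRing R] {n : ℕ} (f : Fin n → AddMonoid.End R)
    (T : Fin n →₀ ℕ) : dIter (fun i => ⇑(f i)) T = ⇑(etaD f T) := by
  unfold dIter etaD
  induction List.finRange n with
  | nil => rfl
  | cons i l ih =>
    rw [List.foldr_cons, ih, List.map_cons, List.prod_cons, AddMonoid.End.coe_mul,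
      AddMonoid.End.coe_pow]

theorem etaD_add {R : Type*} [CommRing R] {n : ℕ} (f : Fin n → AddMonoid.End R)
    (hf : ∀ i j, Commute (f i) (f j)) (S T : Fin n →₀ ℕ) :
    etaD f (S + T) = etaD f S * etaD f T := by
  unfold etaD
  induction List.finRange n with
  | nil => simp
  | cons i l ih =>
    have hc : Commute (f i ^ T i) ((l.map (fun i => f i ^ S i)).prod) := by
      apply Commute.list_prod_right
      intro x hx
      obtain ⟨j, _, rfl⟩ := List.mem_map.1 hx
      exact (hf i j).pow_pow _ _
    rw [List.map_cons, List.prod_cons, ih]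
    simp only [List.map_cons, List.prod_cons, Finsupp.add_apply, pow_add]
    rw [mul_assoc, mul_assoc, ← mul_assoc (f i ^ T i), hc.eq, mul_assoc]

theorem mchoose_eq_zero {n : ℕ} {P L : Fin n →₀ ℕ} (h : ¬ L ≤ P) : mchoose P L = 0 := by
  rw [Finsupp.le_def] at h
  push Not at h
  obtain ⟨i, hi⟩ := h
  exact Finset.prod_eq_zero (Finset.mem_univ i) (Nat.choose_eq_zero_of_lt hi)

theorem mchoose_symm_add {n : ℕ} (T L : Fin n →₀ ℕ) : mchoose (T + L) T = mchoose (T + L) L := by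
  unfold mchoose
  refine Finset.prod_congr rfl fun i _ => ?_
  exact Nat.choose_symm_add

theorem eta_one_dim (N p l : ℕ) (hp : p ≤ N) :
    ∑ q ∈ Finset.Iic N, (-1 : ℤ) ^ q * (q.choose l : ℤ) * (p.choose q : ℤ)
      = if p = l then (-1) ^ p else 0 := by
  by_cases hlp : l ≤ p
  · obtain ⟨k, rfl⟩ := Nat.exists_eq_add_of_le hlp
    have h1 : ∑ q ∈ Finset.Iic N, (-1 : ℤ) ^ q * (q.choose l : ℤ) * ((l + k).choose q : ℤ)
        = ∑ q ∈ (Finset.range (k + 1)).map (addLeftEmbedding l),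
          (-1 : ℤ) ^ q * (q.choose l : ℤ) * ((l + k).choose q : ℤ) := by
      symm
      apply Finset.sum_subset
      · intro q hq
        simp at hq ⊢
        omega
      · intro q _ hq
        have : q < l ∨ l + k < q := by
          by_contra hcon
          apply hq
          simp only [Finset.mem_map, Finset.mem_range, addLeftEmbedding_apply]
          exact ⟨q - l, by omega, by omega⟩
        rcases this with h | h
        · simp [Nat.choose_eq_zero_of_lt h]
        · simp [Nat.choose_eq_zero_of_lt h]
    rw [h1, Finset.sum_map]
    have h2 : ∀ m ∈ Finset.range (k + 1),
        (-1 : ℤ) ^ (addLeftEmbedding l m) * ((addLeftEmbedding l m).choose l : ℤ)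
          * ((l + k).choose (addLeftEmbedding l m) : ℤ)
        = ((-1) ^ l * ((l + k).choose l : ℤ)) * ((-1) ^ m * (k.choose m : ℤ)) := by
      intro m hm
      have hm : m ≤ k := by simpa [Nat.lt_succ_iff] using hm
      have := Nat.choose_mul (n := l + k) (k := l + m) (s := l) (by omega)
      simp only [Nat.add_sub_cancel_left] at this
      have h' : ((l + k).choose (l + m) : ℤ) * ((l + m).choose l : ℤ)
        = ((l + k).choose l : ℤ) * (k.choose m : ℤ) := by exact_mod_cast this
      simp only [addLeftEmbedding_apply, pow_add]
      linear_combination (-1) ^ l * (-1) ^ m * h'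
    rw [Finset.sum_congr rfl h2, ← Finset.mul_sum, Int.alternating_sum_range_choose]
    by_cases hk : k = 0
    · simp [hk]
    · simp [hk]
  · rw [if_neg (by omega)]
    apply Finset.sum_eq_zero
    intro q _
    rcases lt_or_ge q l with h | h
    · simp [Nat.choose_eq_zero_of_lt h]
    · simp [Nat.choose_eq_zero_of_lt (show p < q by omega)]

theorem eta_multi_dim {n : ℕ} (N P L : Fin n →₀ ℕ) (hP : P ≤ N) :
    ∑ Q ∈ Finset.Iic N, (-1 : ℤ) ^ msize Q * (mchoose Q L : ℤ) * (mchoose P Q : ℤ)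
      = if P = L then (-1) ^ msize P else 0 := by
  have h1 : ∑ Q ∈ Finset.Iic N, (-1 : ℤ) ^ msize Q * (mchoose Q L : ℤ) * (mchoose P Q : ℤ)
      = ∑ q ∈ Fintype.piFinset (fun i => Finset.Iic (N i)),
        ∏ i, ((-1 : ℤ) ^ q i * ((q i).choose (L i) : ℤ) * ((P i).choose (q i) : ℤ)) := by
    refine Finset.sum_equiv Finsupp.equivFunOnFinite ?_ ?_
    · intro Q
      simp [Finsupp.le_def]
    · intro Q _
      simp [msize, mchoose, Finset.prod_mul_distrib, Finset.prod_pow_eq_pow_sum]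
  rw [h1, ← Finset.prod_univ_sum (fun i => Finset.Iic (N i))
    (fun i q => (-1 : ℤ) ^ q * (q.choose (L i) : ℤ) * ((P i).choose q : ℤ))]
  rw [Finset.prod_congr rfl fun i _ => eta_one_dim (N i) (P i) (L i) (hP i)]
  split_ifs with h
  · subst h
    simp [msize, Finset.prod_pow_eq_pow_sum]
  · obtain ⟨i, hi⟩ := Finsupp.ne_iff.1 h
    exact Finset.prod_eq_zero (Finset.mem_univ i) (if_neg hi)

theorem etaOp_eq_sum {R : Type*} [CommRing R] {n : ℕ} (f : Fin n → AddMonoid.End R)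
    (B : (Fin n →₀ ℕ) → R) (N : Fin n →₀ ℕ) (hN : ∀ P, ¬ P ≤ N → B P = 0) (L : Fin n →₀ ℕ) :
    etaOp (fun i => ⇑(f i)) B L
      = ∑ P ∈ Finset.Iic N, ((-1 : ℤ) ^ msize P * (mchoose P L : ℤ)) • etaD f (P - L) (B P) := by
  unfold etaOp
  simp only [dIter_eq_etaD, mchoose_symm_add]
  rw [finsum_eq_sum_of_support_subset (s := Finset.Iic N)]
  · have h1 : ∀ P ∈ Finset.Iic N, P ∉ (Finset.Iic N).filter (L ≤ ·) →
        ((-1 : ℤ) ^ msize P * (mchoose P L : ℤ)) • etaD f (P - L) (B P) = 0 := by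
      intro P hP h
      have : ¬ L ≤ P := fun h' => h (Finset.mem_filter.2 ⟨hP, h'⟩)
      simp [mchoose_eq_zero this]
    rw [← Finset.sum_subset (Finset.filter_subset (L ≤ ·) (Finset.Iic N)) h1]
    have h2 : ∀ T ∈ Finset.Iic N, T ∉ (Finset.Iic N).filter (fun T => T + L ≤ N) →
        (-1 : R) ^ msize (T + L) * (mchoose (T + L) L : R) * etaD f T (B (T + L)) = 0 := by
      intro T hT h
      have : ¬ T + L ≤ N := fun h' => h (Finset.mem_filter.2 ⟨hT, h'⟩)
      simp [hN _ this]
    rw [← Finset.sum_subset (Finset.filter_subset (fun T => T + L ≤ N) (Finset.Iic N)) h2]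
    refine Finset.sum_bij' (fun T _ => T + L) (fun P _ => P - L) ?_ ?_ ?_ ?_ ?_
    · intro T hT
      simp only [Finset.mem_filter, Finset.mem_Iic] at hT ⊢
      exact ⟨hT.2, le_add_self⟩
    · intro P hP
      simp only [Finset.mem_filter, Finset.mem_Iic] at hP ⊢
      rw [tsub_add_cancel_of_le hP.2]
      exact ⟨tsub_le_self.trans hP.1, hP.1⟩
    · intro T _
      simp
    · intro P hP
      simp only [Finset.mem_filter, Finset.mem_Iic] at hP
      exact tsub_add_cancel_of_le hP.2
    · intro T _
      simp [zsmul_eq_mul]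
  · intro T hT
    simp only [Finset.coe_Iic, Set.mem_Iic]
    by_contra h
    apply hT
    have : ¬ T + L ≤ N := fun h' => h (le_self_add.trans h')
    simp [hN _ this]

/-- The operator `η` is an involution (relation (0606)): `η(η(B))^Λ = B^Λ`. -/
theorem etaOp_involutive {R : Type*} [CommRing R] {n : ℕ} (hn : 1 ≤ n)
    (d : Fin n → R → R)
    (hadd : ∀ i a b, d i (a + b) = d i a + d i b)
    (hmul : ∀ i a b, d i (a * b) = a * d i b + d i a * b)
    (hcomm : ∀ i j, d i ∘ d j = d j ∘ d i)
    (B : (Fin n →₀ ℕ) → R) (hB : (Function.support B).Finite) (Λ : Fin n →₀ ℕ) :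
    etaOp d (etaOp d B) Λ = B Λ := by
  obtain ⟨f, rfl⟩ : ∃ f : Fin n → AddMonoid.End R, d = fun i => ⇑(f i) :=
    ⟨fun i => AddMonoidHom.mk' (d i) (hadd i), rfl⟩
  have hf : ∀ i j, Commute (f i) (f j) := fun i j =>
    AddMonoidHom.ext fun x => congrFun (hcomm i j) x
  obtain ⟨N, hN'⟩ := hB.bddAbove
  have hN : ∀ P, ¬ P ≤ N → B P = 0 := fun P hP => by
    by_contra h
    exact hP (hN' h)
  have hE : ∀ P, ¬ P ≤ N → etaOp (fun i => ⇑(f i)) B P = 0 := by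
    intro P hP
    rw [etaOp_eq_sum f B N hN]
    refine Finset.sum_eq_zero fun Q hQ => ?_
    have : ¬ P ≤ Q := fun h => hP (h.trans (Finset.mem_Iic.1 hQ))
    simp [mchoose_eq_zero this]
  rw [etaOp_eq_sum f _ N hE]
  have key : ∀ Q P : Fin n →₀ ℕ,
      ((-1 : ℤ) ^ msize Q * (mchoose Q Λ : ℤ)) • etaD f (Q - Λ)
        (((-1 : ℤ) ^ msize P * (mchoose P Q : ℤ)) • etaD f (P - Q) (B P))
      = ((-1 : ℤ) ^ msize Q * (mchoose Q Λ : ℤ) * (mchoose P Q : ℤ)) •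
        ((-1 : ℤ) ^ msize P • etaD f (P - Λ) (B P)) := by
    intro Q P
    by_cases h1 : Λ ≤ Q
    · by_cases h2 : Q ≤ P
      · have : P - Λ = (Q - Λ) + (P - Q) := by
          rw [add_comm, tsub_add_tsub_cancel h2 h1]
        rw [this, etaD_add f hf, map_zsmul, AddMonoid.End.coe_mul, Function.comp_apply, smul_smul, smul_smul]
        congr 1
        ring
      · simp [mchoose_eq_zero h2]
    · simp [mchoose_eq_zero h1]
  simp only [etaOp_eq_sum f B N hN, map_sum, Finset.smul_sum, key]
  rw [Finset.sum_comm]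
  simp only [← Finset.sum_smul]
  rw [Finset.sum_congr rfl fun P hP => by rw [eta_multi_dim N P Λ (Finset.mem_Iic.1 hP)]]
  by_cases hL : Λ ≤ N
  · rw [Finset.sum_eq_single Λ]
    · rw [if_pos rfl, smul_smul, ← mul_pow]
      have : etaD f (Λ - Λ) = 1 := by
        simp [etaD]
      rw [this]
      simp
    · intro P _ h
      simp [h]
    · intro h
      exact absurd (Finset.mem_Iic.2 hL) h
  · rw [hN _ hL]
    refine Finset.sum_eq_zero fun P hP => ?_
    have : P ≠ Λ := fun h => hL (h ▸ Finset.mem_Iic.1 hP)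
    simp [this]
end

section
/- Anti-homomorphism property of the formal adjoint (Proposition 0621, relations (0622), in operator form): for all finitely supported families B, B' : (Fin n →₀ ℕ) → R and all f, g ∈ R, there exist σ^0, …, σ^{n−1} ∈ R such that D_B(D_{B'}(f)) · g − f · D_{B'}^†(D_B^†(g)) = Σ_λ d_λ(σ^λ); i.e. the composition of the adjoint operators in reversed order is an adjoint of the composed operator up to a total divergence. -/
/-- The linear differential operator `D_B (f) = ∑_Λ B^Λ * d_Λ f` associated to a
finitely supported family `B`. -/
noncomputable def Dop {R : Type*} [CommRing R] {n : ℕ}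
    (d : Fin n → R → R) (B : (Fin n →₀ ℕ) → R) (f : R) : R :=
  ∑ᶠ Λ : Fin n →₀ ℕ, B Λ * dIter d Λ f

/-- The formal adjoint `D_B† (f) = ∑_Λ (-1)^{|Λ|} d_Λ (B^Λ * f)`. -/
noncomputable def Dadj {R : Type*} [CommRing R] {n : ℕ}
    (d : Fin n → R → R) (B : (Fin n →₀ ℕ) → R) (f : R) : R :=
  ∑ᶠ Λ : Fin n →₀ ℕ, (-1 : R) ^ msize Λ * dIter d Λ (B Λ * f)

/-- The additive subgroup of total divergences. -/
def divSub {R : Type*} [CommRing R] {n : ℕ} (d : Fin n → R → R)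
    (hadd : ∀ i a b, d i (a + b) = d i a + d i b) : AddSubgroup R :=
  (∑ l, (AddMonoidHom.mk' (d l) (hadd l)).comp (Pi.evalAddMonoidHom (fun _ : Fin n => R) l)).range

theorem mem_divSub {R : Type*} [CommRing R] {n : ℕ} (d : Fin n → R → R)
    (hadd : ∀ i a b, d i (a + b) = d i a + d i b) (x : R) :
    x ∈ divSub d hadd ↔ ∃ σ : Fin n → R, x = ∑ l, d l (σ l) := by
  simp [divSub, AddMonoidHom.mem_range, AddMonoidHom.finsetSum_apply, eq_comm]

theorem d_mem_divSub {R : Type*} [CommRing R] {n : ℕ} (d : Fin n → R → R)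
    (hadd : ∀ i a b, d i (a + b) = d i a + d i b) (i : Fin n) (x : R) :
    d i x ∈ divSub d hadd := by
  rw [mem_divSub]
  have h0 : ∀ j, d j 0 = 0 := fun j => (AddMonoidHom.mk' (d j) (hadd j)).map_zero
  refine ⟨Pi.single i x, ?_⟩
  rw [Finset.sum_eq_single i]
  · simp
  · intro j _ hj
    simp [Pi.single_eq_of_ne hj, h0]
  · simp

theorem pow_adj {R : Type*} [CommRing R] {n : ℕ} (d : Fin n → R → R)
    (hadd : ∀ i a b, d i (a + b) = d i a + d i b)
    (hmul : ∀ i a b, d i (a * b) = a * d i b + d i a * b) (i : Fin n) (k : ℕ) :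
    ∀ a b : R, (d i)^[k] a * b - (-1) ^ k * (a * (d i)^[k] b) ∈ divSub d hadd := by
  induction k with
  | zero => intro a b; simp
  | succ k ih =>
    intro a b
    have h1 := ih (d i a) b
    have h2 := d_mem_divSub d hadd i (a * (d i)^[k] b)
    rw [hmul] at h2
    rw [Function.iterate_succ_apply, Function.iterate_succ_apply' _ _ b]
    rcases neg_one_pow_eq_or R k with hk | hk
    · have := add_mem h1 h2
      rw [pow_succ, hk] at *
      convert this using 1
      ring
    · have := sub_mem h1 h2
      rw [pow_succ, hk] at *
      convert this using 1
      ring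

theorem list_adj {R : Type*} [CommRing R] {n : ℕ} (d : Fin n → R → R)
    (hadd : ∀ i a b, d i (a + b) = d i a + d i b)
    (hmul : ∀ i a b, d i (a * b) = a * d i b + d i a * b)
    (hcomm : ∀ i j, d i ∘ d j = d j ∘ d i) (Λ : Fin n →₀ ℕ) (L : List (Fin n)) :
    (∀ j, Function.Commute (d j) (L.foldr (fun i acc => (d i)^[Λ i] ∘ acc) id)) ∧
    ∀ a b : R, L.foldr (fun i acc => (d i)^[Λ i] ∘ acc) id a * b
      - (-1) ^ (L.map Λ).sum * (a * L.foldr (fun i acc => (d i)^[Λ i] ∘ acc) id b)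
      ∈ divSub d hadd := by
  have hc : ∀ i j, Function.Commute (d i) (d j) := fun i j x => congrFun (hcomm i j) x
  induction L with
  | nil => exact ⟨fun j x => rfl, fun a b => by simp⟩
  | cons i L ih =>
    obtain ⟨ih1, ih2⟩ := ih
    simp only [List.foldr_cons, List.map_cons, List.sum_cons]
    generalize L.foldr (fun i acc => (d i)^[Λ i] ∘ acc) id = F at *
    refine ⟨fun j => ((hc j i).iterate_right _).comp_right (ih1 j), fun a b => ?_⟩
    have h1 := pow_adj d hadd hmul i (Λ i) (F a) b
    have h2 := ih2 a ((d i)^[Λ i] b)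
    rw [← ((ih1 i).iterate_left (Λ i)) b] at h2
    simp only [Function.comp_apply]
    rw [pow_add]
    rcases neg_one_pow_eq_or R (Λ i) with hk | hk
    · have := add_mem h1 h2
      rw [hk] at *
      convert this using 1
      ring
    · have := sub_mem h1 h2
      rw [hk] at *
      convert this using 1
      ring

theorem dIter_adj {R : Type*} [CommRing R] {n : ℕ} (d : Fin n → R → R)
    (hadd : ∀ i a b, d i (a + b) = d i a + d i b)
    (hmul : ∀ i a b, d i (a * b) = a * d i b + d i a * b)
    (hcomm : ∀ i j, d i ∘ d j = d j ∘ d i) (Λ : Fin n →₀ ℕ) (a b : R) :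
    dIter d Λ a * b - (-1) ^ msize Λ * (a * dIter d Λ b) ∈ divSub d hadd := by
  have := (list_adj d hadd hmul hcomm Λ (List.finRange n)).2 a b
  rwa [← List.ofFn_eq_map, List.sum_ofFn] at this

theorem dIter_zero' {R : Type*} [CommRing R] {n : ℕ} (d : Fin n → R → R)
    (hadd : ∀ i a b, d i (a + b) = d i a + d i b) (Λ : Fin n →₀ ℕ) :
    dIter d Λ 0 = 0 := by
  have h0 : ∀ j, d j 0 = 0 := fun j => (AddMonoidHom.mk' (d j) (hadd j)).map_zero
  unfold dIter
  induction List.finRange n with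
  | nil => rfl
  | cons i L ih =>
    simp only [List.foldr_cons, Function.comp_apply, ih]
    exact Function.iterate_fixed (h0 i) _

theorem Dop_adj {R : Type*} [CommRing R] {n : ℕ} (d : Fin n → R → R)
    (hadd : ∀ i a b, d i (a + b) = d i a + d i b)
    (hmul : ∀ i a b, d i (a * b) = a * d i b + d i a * b)
    (hcomm : ∀ i j, d i ∘ d j = d j ∘ d i)
    (B : (Fin n →₀ ℕ) → R) (hB : (Function.support B).Finite) (f g : R) :
    Dop d B f * g - f * Dadj d B g ∈ divSub d hadd := by
  unfold Dop Dadj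
  rw [finsum_eq_sum_of_support_subset (s := hB.toFinset),
    finsum_eq_sum_of_support_subset (s := hB.toFinset),
    Finset.sum_mul, Finset.mul_sum, ← Finset.sum_sub_distrib]
  · refine sum_mem fun Λ _ => ?_
    convert dIter_adj d hadd hmul hcomm Λ f (B Λ * g) using 1
    ring
  · intro Λ h
    simp only [Set.Finite.coe_toFinset, Function.mem_support] at h ⊢
    intro h'
    simp [h', dIter_zero' d hadd] at h
  · intro Λ h
    simp only [Set.Finite.coe_toFinset, Function.mem_support] at h ⊢
    intro h'
    simp [h'] at h

/-- Anti-homomorphism property of the formal adjoint (Proposition 0621,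
relations (0622), in operator form): `D_B (D_{B'} f) * g - f * D_{B'}† (D_B† g)`
is a total divergence. -/
theorem adjoint_antihom {R : Type*} [CommRing R] {n : ℕ} (hn : 1 ≤ n)
    (d : Fin n → R → R)
    (hadd : ∀ i a b, d i (a + b) = d i a + d i b)
    (hmul : ∀ i a b, d i (a * b) = a * d i b + d i a * b)
    (hcomm : ∀ i j, d i ∘ d j = d j ∘ d i)
    (B B' : (Fin n →₀ ℕ) → R)
    (hB : (Function.support B).Finite) (hB' : (Function.support B').Finite)
    (f g : R) :
    ∃ σ : Fin n → R,
      Dop d B (Dop d B' f) * g - f * Dadj d B' (Dadj d B g) = ∑ l, d l (σ l) := by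
  rw [← mem_divSub d hadd]
  have h1 := Dop_adj d hadd hmul hcomm B hB (Dop d B' f) g
  have h2 := Dop_adj d hadd hmul hcomm B' hB' f (Dadj d B g)
  have := add_mem h1 h2
  rwa [sub_add_sub_cancel] at this
end

section
/- Commutator of partial and total derivatives in the differential polynomial ring: for all i ∈ ι, Λ ∈ M, λ ∈ Fin n and f ∈ R, pderiv (i,Λ) (d_λ f) = d_λ (pderiv (i,Λ) f) + (if Λ(λ) ≥ 1 then pderiv (i, Λ − e_λ) f else 0). -/
/-- The total derivative `d_λ` on the ring of differential polynomials
`R = MvPolynomial (ι × M) k`, the unique `k`-derivation with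
`d_λ (X (i, Λ)) = X (i, Λ + e_λ)`. -/
noncomputable def totalDeriv (k : Type*) [CommRing k] {n : ℕ} (ι : Type*) (l : Fin n) :
    Derivation k (MvPolynomial (ι × (Fin n →₀ ℕ)) k) (MvPolynomial (ι × (Fin n →₀ ℕ)) k) :=
  MvPolynomial.mkDerivation k fun p => MvPolynomial.X (p.1, p.2 + Finsupp.single l 1)

/-- Commutator of partial and total derivatives in the differential polynomial ring:
`∂_{(i,Λ)} (d_λ f) = d_λ (∂_{(i,Λ)} f) + (if Λ λ ≥ 1 then ∂_{(i, Λ - e_λ)} f else 0)`. -/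
theorem pderiv_totalDeriv_comm (k : Type*) [CommRing k] (n : ℕ) (hn : 1 ≤ n) (ι : Type*)
    (i : ι) (Λ : Fin n →₀ ℕ) (l : Fin n) (f : MvPolynomial (ι × (Fin n →₀ ℕ)) k) :
    MvPolynomial.pderiv (i, Λ) (totalDeriv k ι l f)
      = totalDeriv k ι l (MvPolynomial.pderiv (i, Λ) f)
        + (if 1 ≤ Λ l then MvPolynomial.pderiv (i, Λ - Finsupp.single l 1) f else 0) := by
  classical
  have key : ⁅MvPolynomial.pderiv (R := k) (i, Λ), totalDeriv k ι l⁆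
      = if 1 ≤ Λ l then MvPolynomial.pderiv (i, Λ - Finsupp.single l 1) else 0 := by
    apply MvPolynomial.derivation_ext
    rintro ⟨j, m⟩
    have hX : ∀ a : Fin n →₀ ℕ, totalDeriv k ι l (MvPolynomial.X (j, a))
        = MvPolynomial.X (j, a + Finsupp.single l 1) := fun a =>
      MvPolynomial.mkDerivation_X _ _ _
    have h0 : totalDeriv k ι l (MvPolynomial.pderiv (i, Λ) (MvPolynomial.X (j, m))) = 0 := by
      rw [MvPolynomial.pderiv_X, Pi.single_apply]
      split_ifs <;> simp
    rw [Derivation.commutator_apply, hX, h0, sub_zero, MvPolynomial.pderiv_X, Pi.single_apply]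
    split_ifs with h1 h2 h2
    · obtain ⟨rfl, rfl⟩ := Prod.mk.inj h1
      simp
    · obtain ⟨rfl, rfl⟩ := Prod.mk.inj h1
      simp at h2
    · rw [MvPolynomial.pderiv_X, Pi.single_apply, if_neg]
      intro h3
      obtain ⟨rfl, rfl⟩ := Prod.mk.inj h3
      apply h1
      rw [tsub_add_cancel_of_le]
      simpa using h2
    · simp
  have h := congrArg (fun D => D f) key
  simp only [Derivation.commutator_apply] at h
  rw [sub_eq_iff_eq_add'] at h
  rw [h]
  split_ifs <;> simp
end

section
/- The Euler–Lagrange operator annihilates total divergences (the identity δ ∘ d_H = 0 used by the paper): for every σ ∈ R, every λ ∈ Fin n and every i ∈ ι, E_i(d_λ σ) = 0. -/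
/-- The Euler–Lagrange derivative `E_i (L) = ∑_Λ (-1)^{|Λ|} d_Λ (∂_{(i,Λ)} L)`. -/
noncomputable def EL (k : Type*) [CommRing k] {n : ℕ} (ι : Type*) (i : ι)
    (L : MvPolynomial (ι × (Fin n →₀ ℕ)) k) : MvPolynomial (ι × (Fin n →₀ ℕ)) k :=
  ∑ᶠ Λ : Fin n →₀ ℕ, (-1 : MvPolynomial (ι × (Fin n →₀ ℕ)) k) ^ msize Λ *
    dIter (fun l => ⇑(totalDeriv k ι l)) Λ (MvPolynomial.pderiv (i, Λ) L)

theorem totalDeriv_X_aux (k : Type*) [CommRing k] {n : ℕ} (ι : Type*) (l : Fin n)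
    (p : ι × (Fin n →₀ ℕ)) :
    totalDeriv k ι l (MvPolynomial.X p) = MvPolynomial.X (p.1, p.2 + Finsupp.single l 1) := by
  simp [totalDeriv, MvPolynomial.mkDerivation_X]

theorem totalDeriv_comm_aux (k : Type*) [CommRing k] {n : ℕ} (ι : Type*) (l m : Fin n)
    (x : MvPolynomial (ι × (Fin n →₀ ℕ)) k) :
    totalDeriv k ι l (totalDeriv k ι m x) = totalDeriv k ι m (totalDeriv k ι l x) := by
  have h : ⁅totalDeriv k ι l, totalDeriv k ι m⁆ = 0 := by
    apply MvPolynomial.derivation_ext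
    intro p
    simp only [Derivation.commutator_apply, totalDeriv_X_aux, Derivation.zero_apply]
    rw [add_right_comm, sub_self]
  have h2 := congrArg (fun D => D x) h
  simp only [Derivation.commutator_apply, Derivation.zero_apply] at h2
  exact sub_eq_zero.mp h2

theorem pderiv_totalDeriv_zero_aux (k : Type*) [CommRing k] {n : ℕ} (ι : Type*) (l : Fin n)
    (i : ι) (Λ : Fin n →₀ ℕ) (hΛ : Λ l = 0) (x : MvPolynomial (ι × (Fin n →₀ ℕ)) k) :
    MvPolynomial.pderiv (i, Λ) (totalDeriv k ι l x) =
      totalDeriv k ι l (MvPolynomial.pderiv (i, Λ) x) := by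
  classical
  have h : ⁅MvPolynomial.pderiv (R := k) (i, Λ), totalDeriv k ι l⁆ = 0 := by
    apply MvPolynomial.derivation_ext
    rintro ⟨j, M⟩
    simp only [Derivation.commutator_apply, totalDeriv_X_aux, Derivation.zero_apply,
      MvPolynomial.pderiv_X]
    have h1 : ((j, M + Finsupp.single l 1) : ι × (Fin n →₀ ℕ)) ≠ (i, Λ) := by
      intro h
      have := (Prod.mk.inj h).2
      rw [← this] at hΛ
      simp at hΛ
    rw [Pi.single_apply, Pi.single_apply, if_neg (fun h => h1 h)]
    split_ifs <;> simp
  have h2 := congrArg (fun D => D x) h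
  simp only [Derivation.commutator_apply, Derivation.zero_apply] at h2
  exact sub_eq_zero.mp h2

theorem pderiv_totalDeriv_succ_aux (k : Type*) [CommRing k] {n : ℕ} (ι : Type*) (l : Fin n)
    (i : ι) (Λ : Fin n →₀ ℕ) (x : MvPolynomial (ι × (Fin n →₀ ℕ)) k) :
    MvPolynomial.pderiv (i, Λ + Finsupp.single l 1) (totalDeriv k ι l x) =
      totalDeriv k ι l (MvPolynomial.pderiv (i, Λ + Finsupp.single l 1) x) +
        MvPolynomial.pderiv (i, Λ) x := by
  classical
  have h : ⁅MvPolynomial.pderiv (R := k) (i, Λ + Finsupp.single l 1), totalDeriv k ι l⁆ =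
      MvPolynomial.pderiv (R := k) (i, Λ) := by
    apply MvPolynomial.derivation_ext
    rintro ⟨j, M⟩
    simp only [Derivation.commutator_apply, totalDeriv_X_aux,
      MvPolynomial.pderiv_X, Pi.single_apply, Prod.mk.injEq, add_left_inj]
    split_ifs <;> simp
  have h2 := congrArg (fun D => D x) h
  simp only [Derivation.commutator_apply] at h2
  rw [← h2]; ring

section dIterAux
variable {R : Type*} [AddCommGroup R] {n : ℕ} (d : Fin n → R →+ R)

theorem dIter_foldr_comm_aux (hc : ∀ a b x, d a (d b x) = d b (d a x)) (Λ : Fin n →₀ ℕ)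
    (l : Fin n) (L : List (Fin n)) (x : R) :
    L.foldr (fun i acc => (d i)^[Λ i] ∘ acc) id (d l x) =
      d l (L.foldr (fun i acc => (d i)^[Λ i] ∘ acc) id x) := by
  induction L with
  | nil => rfl
  | cons a L ih =>
    simp only [List.foldr_cons, Function.comp_apply]
    rw [ih]
    exact (Function.Commute.iterate_left (f := d a) (g := d l) (fun y => hc a l y) (Λ a)) _

theorem dIter_foldr_not_mem_aux (Λ : Fin n →₀ ℕ)
    (l : Fin n) (L : List (Fin n)) (hl : l ∉ L) (x : R) :
    L.foldr (fun i acc => (d i)^[(Λ + Finsupp.single l 1 : Fin n →₀ ℕ) i] ∘ acc) id x =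
      L.foldr (fun i acc => (d i)^[Λ i] ∘ acc) id x := by
  induction L with
  | nil => rfl
  | cons a L ih =>
    simp only [List.mem_cons, not_or] at hl
    simp only [List.foldr_cons, Function.comp_apply]
    rw [ih hl.2]
    simp [Finsupp.single_apply, hl.1]

theorem dIter_foldr_mem_aux (hc : ∀ a b x, d a (d b x) = d b (d a x)) (Λ : Fin n →₀ ℕ)
    (l : Fin n) (L : List (Fin n)) (hn : L.Nodup) (hl : l ∈ L) (x : R) :
    L.foldr (fun i acc => (d i)^[(Λ + Finsupp.single l 1 : Fin n →₀ ℕ) i] ∘ acc) id x =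
      L.foldr (fun i acc => (d i)^[Λ i] ∘ acc) id (d l x) := by
  induction L with
  | nil => simp at hl
  | cons a L ih =>
    rw [List.nodup_cons] at hn
    simp only [List.foldr_cons, Function.comp_apply]
    by_cases h : l = a
    · subst h
      rw [dIter_foldr_not_mem_aux d Λ l L hn.1, dIter_foldr_comm_aux d hc]
      simp
    · have hl' : l ∈ L := by simpa [h] using hl
      rw [ih hn.2 hl']
      simp [Finsupp.single_apply, h]

theorem dIter_single_aux (hc : ∀ a b x, d a (d b x) = d b (d a x)) (Λ : Fin n →₀ ℕ)
    (l : Fin n) (x : R) :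
    dIter (fun a => ⇑(d a)) (Λ + Finsupp.single l 1) x = dIter (fun a => ⇑(d a)) Λ (d l x) :=
  dIter_foldr_mem_aux d hc Λ l _ (List.nodup_finRange n) (List.mem_finRange l) x

theorem dIter_add_aux (Λ : Fin n →₀ ℕ) (x y : R) :
    dIter (fun a => ⇑(d a)) Λ (x + y) =
      dIter (fun a => ⇑(d a)) Λ x + dIter (fun a => ⇑(d a)) Λ y := by
  unfold dIter
  induction List.finRange n with
  | nil => rfl
  | cons a L ih =>
    simp only [List.foldr_cons, Function.comp_apply]
    rw [ih, iterate_map_add]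

theorem dIter_zero_aux (Λ : Fin n →₀ ℕ) :
    dIter (fun a => ⇑(d a)) Λ 0 = 0 := by
  have h := dIter_add_aux d Λ 0 0
  rw [add_zero] at h
  exact left_eq_add.mp h

end dIterAux

theorem finsum_shift_aux {A B : Type*} [AddCommGroup B] (e : A → A) (he : Function.Injective e)
    (f g : A → B) (hf : f.support.Finite) (h0 : ∀ a, a ∉ Set.range e → g a = f a)
    (h1 : ∀ a, g (e a) = f (e a) - f a) : ∑ᶠ a, g a = 0 := by
  classical
  have key : ∀ a, g a = f a - Function.extend e f 0 a := by
    intro a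
    by_cases ha : a ∈ Set.range e
    · obtain ⟨b, rfl⟩ := ha
      rw [h1, he.extend_apply]
    · rw [h0 a ha, Function.extend_apply' _ _ _ (by simpa using ha)]
      simp
  have hs : (Function.extend e f 0).support ⊆ e '' f.support := by
    intro a ha
    by_cases hr : ∃ b, e b = a
    · obtain ⟨b, rfl⟩ := hr
      refine ⟨b, ?_, rfl⟩
      simpa [he.extend_apply] using ha
    · simp [Function.extend_apply' _ _ _ hr] at ha
  have hfin := (hf.image e).subset hs
  rw [finsum_congr key, finsum_sub_distrib hf hfin]
  have : ∑ᶠ a, Function.extend e f 0 a = ∑ᶠ a, f a := by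
    rw [← finsum_mem_univ f]
    rw [← finsum_mem_support (Function.extend e f 0)]
    rw [finsum_mem_inter_support_eq _ _ (Set.range e) (by
      ext a
      constructor
      · rintro ⟨h, -⟩
        obtain ⟨b, -, rfl⟩ := hs h
        exact ⟨⟨b, rfl⟩, h⟩
      · rintro ⟨-, h⟩
        exact ⟨h, h⟩)]
    rw [finsum_mem_range he, finsum_mem_univ]
    exact finsum_congr fun b => he.extend_apply _ _ _
  rw [this, sub_self]

/-- The Euler–Lagrange operator annihilates total divergences (`δ ∘ d_H = 0`):
`E_i (d_λ σ) = 0`. -/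
theorem EL_totalDeriv (k : Type*) [CommRing k] (n : ℕ) (hn : 1 ≤ n) (ι : Type*)
    (σ : MvPolynomial (ι × (Fin n →₀ ℕ)) k) (l : Fin n) (i : ι) :
    EL k ι i (totalDeriv k ι l σ) = 0 := by
  classical
  let d : Fin n → MvPolynomial (ι × (Fin n →₀ ℕ)) k →+ MvPolynomial (ι × (Fin n →₀ ℕ)) k :=
    fun a => (totalDeriv k ι a : _ →ₗ[k] _).toAddMonoidHom
  have hc : ∀ a b x, d a (d b x) = d b (d a x) := fun a b x => totalDeriv_comm_aux k ι a b x
  have hsingle : ∀ (Λ : Fin n →₀ ℕ) x, dIter (fun a => ⇑(totalDeriv k ι a))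
      (Λ + Finsupp.single l 1) x = dIter (fun a => ⇑(totalDeriv k ι a)) Λ (totalDeriv k ι l x) :=
    fun Λ x => dIter_single_aux d hc Λ l x
  have hadd : ∀ (Λ : Fin n →₀ ℕ) x y, dIter (fun a => ⇑(totalDeriv k ι a)) Λ (x + y) =
      dIter (fun a => ⇑(totalDeriv k ι a)) Λ x + dIter (fun a => ⇑(totalDeriv k ι a)) Λ y :=
    fun Λ x y => dIter_add_aux d Λ x y
  have hzero : ∀ (Λ : Fin n →₀ ℕ), dIter (fun a => ⇑(totalDeriv k ι a)) Λ 0 = 0 :=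
    fun Λ => dIter_zero_aux d Λ
  unfold EL
  refine finsum_shift_aux (fun Λ => Λ + Finsupp.single l 1) (add_left_injective _)
    (fun Λ => (-1) ^ msize Λ * dIter (fun l => ⇑(totalDeriv k ι l)) Λ
      (totalDeriv k ι l (MvPolynomial.pderiv (i, Λ) σ))) _ ?_ ?_ ?_
  · refine (σ.vars.image Prod.snd).finite_toSet.subset ?_
    intro Λ hΛ
    by_contra hn
    apply hΛ
    have : (i, Λ) ∉ σ.vars := fun h => hn (by
      simp only [Finset.coe_image, Set.mem_image]
      exact ⟨_, h, rfl⟩)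
    simp only [MvPolynomial.pderiv_eq_zero_of_notMem_vars this, map_zero, hzero, mul_zero]
  · intro Λ hΛ
    have h0 : Λ l = 0 := by
      by_contra h
      apply hΛ
      refine ⟨Λ - Finsupp.single l 1, ?_⟩
      apply tsub_add_cancel_of_le
      rw [Finsupp.single_le_iff]
      omega
    simp only [pderiv_totalDeriv_zero_aux k ι l i Λ h0]
  · intro Λ
    have hm : msize (Λ + Finsupp.single l 1) = msize Λ + 1 := by
      simp [msize, Finset.sum_add_distrib, Finsupp.single_apply]
    simp only [pderiv_totalDeriv_succ_aux, hadd, hm]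
    rw [hsingle Λ (MvPolynomial.pderiv (i, Λ) σ)]
    ring
end

section
/- Euler–Lagrange expressions of the local Chern–Simons Lagrangian: for all q ∈ Fin N and λ ∈ Fin 3, E^λ_q = Σ_{n,β,γ} a_{qn} · ε^{λβγ} · ℱ^n_{βγ}, where ℱ^n_{βγ} := d_γ(a^n_β) − d_β(a^n_γ) − Σ_{p,q'} c^n_{pq'} · a^p_β · a^{q'}_γ. -/
/-- The Levi–Civita sign `ε^{αβγ}` on `Fin 3`. -/
def eps (α β γ : Fin 3) : ℝ :=
  if (α, β, γ) = (0, 1, 2) ∨ (α, β, γ) = (1, 2, 0) ∨ (α, β, γ) = (2, 0, 1) then 1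
  else if (α, β, γ) = (0, 2, 1) ∨ (α, β, γ) = (2, 1, 0) ∨ (α, β, γ) = (1, 0, 2) then -1
  else 0

/-- The gauge-potential variable `a^r_λ = X ((r, λ), 0)`. -/
noncomputable def aVar (N : ℕ) (r : Fin N) (l : Fin 3) :
    MvPolynomial ((Fin N × Fin 3) × (Fin 3 →₀ ℕ)) ℝ :=
  MvPolynomial.X ((r, l), 0)

/-- The local Chern–Simons Lagrangian. -/
noncomputable def LCS (N : ℕ) (c : Fin N → Fin N → Fin N → ℝ) (a : Fin N → Fin N → ℝ) :
    MvPolynomial ((Fin N × Fin 3) × (Fin 3 →₀ ℕ)) ℝ :=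
  (∑ m, ∑ n', ∑ α, ∑ β, ∑ γ, MvPolynomial.C (a m n' * eps α β γ) *
      (aVar N m α * totalDeriv ℝ (Fin N × Fin 3) γ (aVar N n' β)))
    - MvPolynomial.C (1 / 3 : ℝ) *
        ∑ m, ∑ n', ∑ p, ∑ q, ∑ α, ∑ β, ∑ γ,
          MvPolynomial.C (eps α β γ * a m n' * c n' p q) *
            (aVar N m α * aVar N p β * aVar N q γ)

/-- The Euler–Lagrange expression `E^λ_q` of the local Chern–Simons Lagrangian. -/
noncomputable def ELCS (N : ℕ) (c : Fin N → Fin N → Fin N → ℝ) (a : Fin N → Fin N → ℝ)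
    (q : Fin N) (l : Fin 3) : MvPolynomial ((Fin N × Fin 3) × (Fin 3 →₀ ℕ)) ℝ :=
  EL ℝ (Fin N × Fin 3) (q, l) (LCS N c a)

/-- The field strength `ℱ^n_{βγ} = d_γ(a^n_β) - d_β(a^n_γ) - ∑_{p,q'} c^n_{pq'} a^p_β a^{q'}_γ`. -/
noncomputable def calF (N : ℕ) (c : Fin N → Fin N → Fin N → ℝ) (n' : Fin N) (β γ : Fin 3) :
    MvPolynomial ((Fin N × Fin 3) × (Fin 3 →₀ ℕ)) ℝ :=
  totalDeriv ℝ (Fin N × Fin 3) γ (aVar N n' β) - totalDeriv ℝ (Fin N × Fin 3) β (aVar N n' γ)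
    - ∑ p, ∑ q', MvPolynomial.C (c n' p q') * (aVar N p β * aVar N q' γ)

open MvPolynomial in
theorem cs_cubic {ι R : Type*} [Fintype ι] [DecidableEq ι] [CommRing R] [Algebra ℝ R]
    (D : Derivation ℝ R R) (x : ι → R) (Q : ι) (K : ι → ι → ι → ℝ)
    (h1 : ∀ A B C, K A B C = K B A C) (h2 : ∀ A B C, K A B C = K A C B)
    (hD : ∀ A, D (x A) = if A = Q then 1 else 0) :
    D (∑ A, ∑ B, ∑ C, K A B C • (x A * x B * x C)) =
      (3 : ℝ) • ∑ B, ∑ C, K Q B C • (x B * x C) := by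
  have e : ∀ A B C, D (K A B C • (x A * x B * x C)) =
      (if A = Q then K A B C • (x B * x C) else 0)
      + (if B = Q then K B A C • (x A * x C) else 0)
      + (if C = Q then K C A B • (x A * x B) else 0) := by
    intro A B C
    have s1 : K B A C = K A B C := (h1 _ _ _)
    have s2 : K C A B = K A B C := by rw [h1, h2]
    rw [s1, s2]
    simp only [Derivation.map_smul, Derivation.leibniz, hD, smul_eq_mul]
    simp only [Algebra.smul_def]
    split_ifs <;> simp <;> ring
  simp only [map_sum, e, Finset.sum_add_distrib]
  have t1 : (∑ A, ∑ B, ∑ C, (if A = Q then K A B C • (x B * x C) else 0))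
      = ∑ B, ∑ C, K Q B C • (x B * x C) := by
    rw [Finset.sum_eq_single Q]
    · simp
    · intro b _ hb; simp [hb]
    · simp
  have t2 : (∑ A, ∑ B, ∑ C, (if B = Q then K B A C • (x A * x C) else 0))
      = ∑ B, ∑ C, K Q B C • (x B * x C) := by
    rw [Finset.sum_comm, ← t1]
  have t3 : (∑ A, ∑ B, ∑ C, (if C = Q then K C A B • (x A * x B) else 0))
      = ∑ B, ∑ C, K Q B C • (x B * x C) := by
    simp
  rw [t1, t2, t3]
  module

/-- the derivative coordinate. -/
noncomputable def yVar (N : ℕ) (A : Fin N × Fin 3) (g : Fin 3) :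
    MvPolynomial ((Fin N × Fin 3) × (Fin 3 →₀ ℕ)) ℝ :=
  MvPolynomial.X (A, Finsupp.single g 1)

/-- the field coordinate. -/
noncomputable def xVar (N : ℕ) (A : Fin N × Fin 3) :
    MvPolynomial ((Fin N × Fin 3) × (Fin 3 →₀ ℕ)) ℝ :=
  MvPolynomial.X (A, 0)

theorem td_x (N : ℕ) (A : Fin N × Fin 3) (g : Fin 3) :
    totalDeriv ℝ (Fin N × Fin 3) g (xVar N A) = yVar N A g := by
  simp [totalDeriv, xVar, yVar, MvPolynomial.mkDerivation_X]

theorem pd_x0 (N : ℕ) (A Q : Fin N × Fin 3) :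
    MvPolynomial.pderiv (Q, 0) (xVar N A) = if A = Q then 1 else 0 := by
  simp only [xVar, MvPolynomial.pderiv_X, Pi.single_apply]
  simp

theorem pd_x (N : ℕ) (A Q : Fin N × Fin 3) (L : Fin 3 →₀ ℕ) (hL : L ≠ 0) :
    MvPolynomial.pderiv (Q, L) (xVar N A) = 0 := by
  simp only [xVar, MvPolynomial.pderiv_X, Pi.single_apply]
  simp [hL.symm]

theorem pd_y (N : ℕ) (A Q : Fin N × Fin 3) (L : Fin 3 →₀ ℕ) (g : Fin 3) :
    MvPolynomial.pderiv (Q, L) (yVar N A g) =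
      if A = Q then (if Finsupp.single g 1 = L then 1 else 0) else 0 := by
  simp only [yVar, MvPolynomial.pderiv_X, Pi.single_apply, Prod.mk.injEq]
  split_ifs <;> simp_all

theorem LCS_form (N : ℕ) (c : Fin N → Fin N → Fin N → ℝ) (a : Fin N → Fin N → ℝ) :
    LCS N c a = (∑ A : Fin N × Fin 3, ∑ B : Fin N × Fin 3, ∑ g,
        (a A.1 B.1 * eps A.2 B.2 g) • (xVar N A * yVar N B g))
      - (1 / 3 : ℝ) • ∑ A : Fin N × Fin 3, ∑ B : Fin N × Fin 3, ∑ C : Fin N × Fin 3,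
        (eps A.2 B.2 C.2 * ∑ n, a A.1 n * c n B.1 C.1) • (xVar N A * xVar N B * xVar N C) := by
  have hx : ∀ r l, aVar N r l = xVar N (r, l) := fun _ _ => rfl
  unfold LCS
  simp only [hx, td_x, ← MvPolynomial.smul_eq_C_mul]
  congr 1
  · simp only [Fintype.sum_prod_type]
    refine Finset.sum_congr rfl fun m _ => ?_
    rw [Finset.sum_comm]
  · congr 1
    simp only [Fintype.sum_prod_type, Finset.mul_sum, Finset.sum_smul]
    refine Finset.sum_congr rfl fun m _ => ?_
    -- LHS: n p q α β γ ; RHS: α p β q γ n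
    simp only [← Fintype.sum_prod_type']
    let e : Fin N × Fin N × Fin N × Fin 3 × Fin 3 × Fin 3 ≃
        Fin 3 × Fin N × Fin 3 × Fin N × Fin 3 × Fin N :=
      ⟨fun ⟨n, p, q, x, y, z⟩ => ⟨x, p, y, q, z, n⟩,
       fun ⟨x, p, y, q, z, n⟩ => ⟨n, p, q, x, y, z⟩,
       fun _ => rfl, fun _ => rfl⟩
    refine Fintype.sum_equiv e _ _ ?_
    rintro ⟨n, p, q, x, y, z⟩
    simp only [e, Equiv.coe_fn_mk, mul_assoc]

theorem eps_12 (x y z : Fin 3) : eps x y z = - eps y x z := by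
  fin_cases x <;> fin_cases y <;> fin_cases z <;> simp [eps]

theorem eps_23 (x y z : Fin 3) : eps x y z = - eps x z y := by
  fin_cases x <;> fin_cases y <;> fin_cases z <;> simp [eps]

theorem dIter_arg_zero {R : Type*} [Zero R] (d : Fin 3 → R → R) (hd : ∀ l, d l 0 = 0)
    (M : Fin 3 →₀ ℕ) : dIter d M 0 = 0 := by
  have key : ∀ (l : Fin 3) (k : ℕ), (d l)^[k] 0 = 0 := by
    intro l k
    induction k with
    | zero => rfl
    | succ k ih => rw [Function.iterate_succ_apply', ih, hd]
  simp [dIter, List.finRange_succ, key]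

theorem dIter_idx_zero {R : Type*} (d : Fin 3 → R → R) (x : R) : dIter d 0 x = x := by
  simp [dIter, List.finRange_succ]

theorem dIter_single {R : Type*} (d : Fin 3 → R → R) (g : Fin 3) (x : R) :
    dIter d (Finsupp.single g 1) x = d g x := by
  fin_cases g <;> simp [dIter, List.finRange_succ, Finsupp.single_apply]

theorem msize_single (g : Fin 3) : msize (Finsupp.single g 1) = 1 := by
  fin_cases g <;> simp [msize, Finsupp.single_apply]

theorem EL_first (N : ℕ) (Q : Fin N × Fin 3)
    (L : MvPolynomial ((Fin N × Fin 3) × (Fin 3 →₀ ℕ)) ℝ)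
    (h : ∀ M : Fin 3 →₀ ℕ, M ≠ 0 → (∀ g, Finsupp.single g 1 ≠ M) →
      MvPolynomial.pderiv (Q, M) L = 0) :
    EL ℝ (Fin N × Fin 3) Q L = MvPolynomial.pderiv (Q, 0) L
      - ∑ g, totalDeriv ℝ (Fin N × Fin 3) g
          (MvPolynomial.pderiv (Q, Finsupp.single g 1) L) := by
  classical
  have hinj : Function.Injective (fun g : Fin 3 => (Finsupp.single g 1 : Fin 3 →₀ ℕ)) :=
    Finsupp.single_left_injective one_ne_zero
  unfold EL
  rw [finsum_eq_sum_of_support_subset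
    (s := insert 0 (Finset.univ.image fun g : Fin 3 => (Finsupp.single g 1 : Fin 3 →₀ ℕ)))]
  · rw [Finset.sum_insert (by simp), Finset.sum_image (fun _ _ _ _ h => hinj h), sub_eq_add_neg,
      ← Finset.sum_neg_distrib]
    congr 1
    · rw [dIter_idx_zero]; simp [msize]
    · refine Finset.sum_congr rfl fun g _ => ?_
      rw [dIter_single, msize_single, pow_one, neg_one_mul]
  · intro M hM
    by_contra hc
    apply hM
    simp only [Finset.coe_insert, Finset.coe_image, Finset.coe_univ, Set.image_univ,
      Set.mem_insert_iff, Set.mem_range, not_or, not_exists] at hc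
    beta_reduce
    rw [h M hc.1 hc.2, dIter_arg_zero _ (fun l => map_zero _), mul_zero]

/-- Euler–Lagrange expressions of the local Chern–Simons Lagrangian:
`E^λ_q = ∑_{n,β,γ} a_{qn} ε^{λβγ} ℱ^n_{βγ}`. -/
theorem ELCS_eq (N : ℕ) (hN : 1 ≤ N) (c : Fin N → Fin N → Fin N → ℝ)
    (hc : ∀ r p q, c r p q = - c r q p)
    (hJacobi : ∀ p q t r,
      ∑ s, (c s p q * c r s t + c s q t * c r s p + c s t p * c r s q) = 0)
    (a : Fin N → Fin N → ℝ) (ha : ∀ m n', a m n' = a n' m)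
    (hinv : ∀ p m n', ∑ s, (c s p m * a s n' + c s p n' * a m s) = 0)
    (q : Fin N) (l : Fin 3) :
    ELCS N c a q l
      = ∑ n', ∑ β, ∑ γ, MvPolynomial.C (a q n' * eps l β γ) * calF N c n' β γ := by
  obtain ⟨Q, hQ⟩ : ∃ Q : Fin N × Fin 3, Q = (q, l) := ⟨_, rfl⟩
  have hT12 : ∀ m p r, ∑ n, a m n * c n p r = - ∑ n, a m n * c n r p := by
    intro m p r
    rw [← Finset.sum_neg_distrib]
    exact Finset.sum_congr rfl fun n _ => by rw [hc n p r]; ring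
  have hT13 : ∀ m p r, ∑ n, a m n * c n p r = - ∑ n, a r n * c n p m := by
    intro m p r
    have := hinv p m r
    rw [Finset.sum_add_distrib] at this
    have e1 : ∑ n, a r n * c n p m = ∑ s, c s p m * a s r :=
      Finset.sum_congr rfl fun s _ => by rw [ha s r]; ring
    have e2 : ∑ n, a m n * c n p r = ∑ s, c s p r * a m s :=
      Finset.sum_congr rfl fun s _ => by ring
    rw [e1, e2]; linarith
  have hcub : ∀ M : Fin 3 →₀ ℕ, M ≠ 0 → MvPolynomial.pderiv (Q, M)
      (∑ A : Fin N × Fin 3, ∑ B : Fin N × Fin 3, ∑ C : Fin N × Fin 3,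
        (eps A.2 B.2 C.2 * ∑ n, a A.1 n * c n B.1 C.1) •
          (xVar N A * xVar N B * xVar N C)) = 0 := by
    intro M hM
    simp [map_sum, Derivation.leibniz, pd_x N _ Q M hM]
  have hcub0 := cs_cubic (MvPolynomial.pderiv (R := ℝ) (Q, (0 : Fin 3 →₀ ℕ))) (xVar N) Q
    (fun A B C => eps A.2 B.2 C.2 * ∑ n, a A.1 n * c n B.1 C.1)
    (by
      intro A B C
      have : ∑ n, a A.1 n * c n B.1 C.1 = - ∑ n, a B.1 n * c n A.1 C.1 := by
        rw [hT12, hT13, hT12, neg_neg]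
      rw [this, eps_12]; ring)
    (by
      intro A B C
      rw [hT12, eps_23]; ring)
    (fun A => pd_x0 N A Q)
  have hy0 : ∀ A g, MvPolynomial.pderiv (Q, (0 : Fin 3 →₀ ℕ)) (yVar N A g) = 0 := by
    intro A g; simp [pd_y]
  have hq0 : MvPolynomial.pderiv (Q, (0 : Fin 3 →₀ ℕ))
      (∑ A : Fin N × Fin 3, ∑ B : Fin N × Fin 3, ∑ g,
        (a A.1 B.1 * eps A.2 B.2 g) • (xVar N A * yVar N B g))
      = ∑ B : Fin N × Fin 3, ∑ g, (a q B.1 * eps l B.2 g) • yVar N B g := by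
    simp only [map_sum, Derivation.map_smul, Derivation.leibniz, hy0, pd_x0, smul_zero, zero_add]
    rw [Finset.sum_eq_single Q]
    · simp [hQ]
    · intro b _ hb; simp [hb]
    · simp
  have hq1 : ∀ M : Fin 3 →₀ ℕ, M ≠ 0 → MvPolynomial.pderiv (Q, M)
      (∑ A : Fin N × Fin 3, ∑ B : Fin N × Fin 3, ∑ g,
        (a A.1 B.1 * eps A.2 B.2 g) • (xVar N A * yVar N B g))
      = ∑ A : Fin N × Fin 3, ∑ g,
        if Finsupp.single g 1 = M then (a A.1 q * eps A.2 l g) • xVar N A else 0 := by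
    intro M hM
    simp only [map_sum, Derivation.map_smul, Derivation.leibniz, pd_x N _ Q M hM, pd_y,
      smul_zero, add_zero]
    refine Finset.sum_congr rfl fun A _ => ?_
    rw [Finset.sum_eq_single Q]
    · refine Finset.sum_congr rfl fun g _ => ?_
      rw [if_pos rfl]
      split_ifs <;> simp [hQ]
    · intro b _ hb; simp [hb]
    · simp
  unfold ELCS
  rw [← hQ]
  rw [EL_first, LCS_form]
  · have hder : ∀ g : Fin 3, totalDeriv ℝ (Fin N × Fin 3) g
        (∑ A : Fin N × Fin 3, ∑ g' : Fin 3,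
          if (Finsupp.single g' 1 : Fin 3 →₀ ℕ) = Finsupp.single g 1
            then (a A.1 q * eps A.2 l g') • xVar N A else 0)
        = - ∑ A : Fin N × Fin 3, (a q A.1 * eps l A.2 g) • yVar N A g := by
      intro g
      rw [map_sum, ← Finset.sum_neg_distrib]
      refine Finset.sum_congr rfl fun A _ => ?_
      simp only [Finsupp.single_left_inj one_ne_zero, Finset.sum_ite_eq',
        Finset.mem_univ, if_true, Derivation.map_smul, td_x]
      rw [ha A.1 q, eps_12 A.2 l g, mul_neg, neg_smul]
    have hs : ∀ g : Fin 3, (Finsupp.single g 1 : Fin 3 →₀ ℕ) ≠ 0 := by simp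
    simp only [map_sub, Derivation.map_smul, hq0, hcub0, hq1 _ (hs _), hcub _ (hs _), smul_zero,
      sub_zero, hder]
    have hx : ∀ r l, aVar N r l = xVar N (r, l) := fun _ _ => rfl
    simp only [calF, hx, td_x, ← MvPolynomial.smul_eq_C_mul, smul_sub, Finset.sum_sub_distrib]
    have r2 : (∑ n, ∑ y, ∑ z, (a q n * eps l y z) • yVar N (n, z) y)
        = - ∑ n, ∑ y, ∑ z, (a q n * eps l y z) • yVar N (n, y) z := by
      rw [← Finset.sum_neg_distrib]
      refine Finset.sum_congr rfl fun n _ => ?_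
      rw [Finset.sum_comm, ← Finset.sum_neg_distrib]
      refine Finset.sum_congr rfl fun y _ => ?_
      rw [← Finset.sum_neg_distrib]
      refine Finset.sum_congr rfl fun z _ => ?_
      rw [eps_23 l z y, mul_neg, neg_smul]
    have r3 : (∑ B : Fin N × Fin 3, ∑ C : Fin N × Fin 3,
        (eps Q.2 B.2 C.2 * ∑ n, a Q.1 n * c n B.1 C.1) • (xVar N B * xVar N C))
        = ∑ n, ∑ y, ∑ z, (a q n * eps l y z) •
          ∑ p, ∑ r, c n p r • (xVar N (p, y) * xVar N (r, z)) := by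
      simp only [Fintype.sum_prod_type, Finset.mul_sum, Finset.sum_smul, Finset.smul_sum]
      simp only [← Fintype.sum_prod_type']
      let e : Fin N × Fin 3 × Fin N × Fin 3 × Fin N ≃ Fin N × Fin 3 × Fin 3 × Fin N × Fin N :=
        ⟨fun ⟨p, y, r, z, n⟩ => ⟨n, y, z, p, r⟩,
         fun ⟨n, y, z, p, r⟩ => ⟨p, y, r, z, n⟩,
         fun _ => rfl, fun _ => rfl⟩
      refine Fintype.sum_equiv e _ _ ?_
      rintro ⟨p, y, r, z, n⟩
      simp only [e, Equiv.coe_fn_mk, smul_smul, hQ]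
      congr 1
      ring
    have r1 : (∑ g, ∑ A : Fin N × Fin 3, (a q A.1 * eps l A.2 g) • yVar N A g)
        = ∑ n, ∑ y, ∑ z, (a q n * eps l y z) • yVar N (n, y) z := by
      rw [Finset.sum_comm, Fintype.sum_prod_type]
    have r1' : (∑ A : Fin N × Fin 3, ∑ g, (a q A.1 * eps l A.2 g) • yVar N A g)
        = ∑ n, ∑ y, ∑ z, (a q n * eps l y z) • yVar N (n, y) z := by
      rw [Fintype.sum_prod_type]
    rw [r2, ← r3, Finset.sum_neg_distrib, r1, r1']
    module
  · intro M hM hM'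
    rw [LCS_form]
    simp only [map_sub, Derivation.map_smul, hq1 M hM, hcub M hM, hM', if_false,
      Finset.sum_const_zero, smul_zero, sub_zero]
end

section
/- Noether identity for the local Chern–Simons Lagrangian (identity (gr1) of the paper): for every q ∈ Fin N, Σ_{r,p,λ} c^r_{pq} · a^p_λ · E^λ_r − Σ_λ d_λ(E^λ_q) = 0 in R. -/
namespace CSaux
open MvPolynomial

abbrev Rg (N : ℕ) := MvPolynomial ((Fin N × Fin 3) × (Fin 3 →₀ ℕ)) ℝ

/-- The invariant form extended to `R`-valued vectors. -/
noncomputable def fr {N : ℕ} (a : Fin N → Fin N → ℝ) (u v : Fin N → Rg N) : Rg N :=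
  ∑ m, ∑ n, C (a m n) * (u m * v n)

/-- The Lie bracket extended to `R`-valued vectors. -/
noncomputable def br {N : ℕ} (c : Fin N → Fin N → Fin N → ℝ) (u v : Fin N → Rg N) :
    Fin N → Rg N :=
  fun n => ∑ p, ∑ r, C (c n p r) * (u p * v r)

/-- A derivation applied componentwise. -/
noncomputable def dv {N : ℕ} (D : Derivation ℝ (Rg N) (Rg N)) (u : Fin N → Rg N) : Fin N → Rg N :=
  fun n => D (u n)

variable {N : ℕ} (c : Fin N → Fin N → Fin N → ℝ) (a : Fin N → Fin N → ℝ)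

lemma fr_add_right (u v w : Fin N → Rg N) : fr a u (v + w) = fr a u v + fr a u w := by
  simp [fr, mul_add, Finset.sum_add_distrib]
lemma fr_sub_right (u v w : Fin N → Rg N) : fr a u (v - w) = fr a u v - fr a u w := by
  simp [fr, mul_sub, Finset.sum_sub_distrib]
lemma fr_zero_right (u : Fin N → Rg N) : fr a u 0 = 0 := by simp [fr]
lemma fr_zero_left (u : Fin N → Rg N) : fr a 0 u = 0 := by simp [fr]
lemma br_add_right (u v w : Fin N → Rg N) : br c u (v + w) = br c u v + br c u w := by
  ext1 n; simp [br, mul_add, Finset.sum_add_distrib]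
lemma br_sub_right (u v w : Fin N → Rg N) : br c u (v - w) = br c u v - br c u w := by
  ext1 n; simp [br, mul_sub, Finset.sum_sub_distrib]

lemma fr_symm (ha : ∀ m n', a m n' = a n' m) (u v : Fin N → Rg N) : fr a u v = fr a v u := by
  unfold fr
  rw [Finset.sum_comm]
  refine Finset.sum_congr rfl fun m _ => Finset.sum_congr rfl fun n _ => ?_
  rw [ha n m, mul_comm (u n)]

lemma br_anti (hc : ∀ r p q, c r p q = - c r q p) (u v : Fin N → Rg N) :
    br c u v = - br c v u := by
  ext1 n
  simp only [br, Pi.neg_apply, ← Finset.sum_neg_distrib]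
  rw [Finset.sum_comm]
  refine Finset.sum_congr rfl fun p _ => Finset.sum_congr rfl fun r _ => ?_
  rw [hc n r p, map_neg]; ring

lemma D_C_mul (D : Derivation ℝ (Rg N) (Rg N)) (r : ℝ) (x : Rg N) : D (C r * x) = C r * D x := by
  rw [← smul_eq_C_mul, ← smul_eq_C_mul, D.map_smul]

lemma D_fr (D : Derivation ℝ (Rg N) (Rg N)) (u v : Fin N → Rg N) :
    D (fr a u v) = fr a (dv D u) v + fr a u (dv D v) := by
  simp only [fr, dv, map_sum, D_C_mul, ← Finset.sum_add_distrib]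
  simp only [Derivation.leibniz, smul_eq_mul]
  refine Finset.sum_congr rfl fun p _ => Finset.sum_congr rfl fun r _ => ?_
  ring

lemma dv_br (D : Derivation ℝ (Rg N) (Rg N)) (u v : Fin N → Rg N) :
    dv D (br c u v) = br c (dv D u) v + br c u (dv D v) := by
  ext1 n
  simp only [br, dv, map_sum, D_C_mul, ← Finset.sum_add_distrib, Pi.add_apply]
  simp only [Derivation.leibniz, smul_eq_mul]
  refine Finset.sum_congr rfl fun p _ => Finset.sum_congr rfl fun r _ => ?_
  ring

lemma dv_add (D : Derivation ℝ (Rg N) (Rg N)) (u v : Fin N → Rg N) :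
    dv D (u + v) = dv D u + dv D v := by ext1 n; simp [dv]
lemma dv_sub (D : Derivation ℝ (Rg N) (Rg N)) (u v : Fin N → Rg N) :
    dv D (u - v) = dv D u - dv D v := by ext1 n; simp [dv]

/-- Invariance. -/
lemma fr_br (hinv : ∀ p m n', ∑ s, (c s p m * a s n' + c s p n' * a m s) = 0)
    (u v w : Fin N → Rg N) : fr a (br c u v) w = - fr a v (br c u w) := by
  have h1 : fr a (br c u v) w = ∑ p, ∑ m, ∑ n, C (∑ s, c s p m * a s n) * (u p * v m * w n) := by
    simp only [fr, br, Finset.sum_mul, Finset.mul_sum, map_sum]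
    calc _ = ∑ s, ∑ p, ∑ n, ∑ m, C (a s n) * (C (c s p m) * (u p * v m) * w n) := by
            exact Finset.sum_congr rfl fun s _ => Finset.sum_comm
      _ = ∑ p, ∑ s, ∑ n, ∑ m, C (a s n) * (C (c s p m) * (u p * v m) * w n) := Finset.sum_comm
      _ = ∑ p, ∑ s, ∑ m, ∑ n, C (a s n) * (C (c s p m) * (u p * v m) * w n) := by
            exact Finset.sum_congr rfl fun p _ => Finset.sum_congr rfl fun s _ => Finset.sum_comm
      _ = ∑ p, ∑ m, ∑ s, ∑ n, C (a s n) * (C (c s p m) * (u p * v m) * w n) := by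
            exact Finset.sum_congr rfl fun p _ => Finset.sum_comm
      _ = ∑ p, ∑ m, ∑ n, ∑ s, C (a s n) * (C (c s p m) * (u p * v m) * w n) := by
            exact Finset.sum_congr rfl fun p _ => Finset.sum_congr rfl fun s _ => Finset.sum_comm
      _ = _ := by
            refine Finset.sum_congr rfl fun p _ => Finset.sum_congr rfl fun m _ =>
              Finset.sum_congr rfl fun n _ => Finset.sum_congr rfl fun s _ => ?_
            rw [C_mul]; ring
  have h2 : fr a v (br c u w) = ∑ p, ∑ m, ∑ n, C (∑ s, c s p n * a m s) * (u p * v m * w n) := by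
    simp only [fr, br, Finset.sum_mul, Finset.mul_sum, map_sum]
    calc _ = ∑ m, ∑ p, ∑ s, ∑ n, C (a m s) * (v m * (C (c s p n) * (u p * w n))) := by
            exact Finset.sum_congr rfl fun s _ => Finset.sum_comm
      _ = ∑ p, ∑ m, ∑ s, ∑ n, C (a m s) * (v m * (C (c s p n) * (u p * w n))) := Finset.sum_comm
      _ = ∑ p, ∑ m, ∑ n, ∑ s, C (a m s) * (v m * (C (c s p n) * (u p * w n))) := by
            exact Finset.sum_congr rfl fun p _ => Finset.sum_congr rfl fun s _ => Finset.sum_comm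
      _ = _ := by
            refine Finset.sum_congr rfl fun p _ => Finset.sum_congr rfl fun m _ =>
              Finset.sum_congr rfl fun n _ => Finset.sum_congr rfl fun s _ => ?_
            rw [C_mul]; ring
  rw [eq_neg_iff_add_eq_zero, h1, h2]
  simp only [← Finset.sum_add_distrib]
  refine Finset.sum_eq_zero fun p _ => Finset.sum_eq_zero fun m _ => Finset.sum_eq_zero fun n _ => ?_
  rw [← add_mul, ← C_add, ← Finset.sum_add_distrib, hinv]; simp

lemma fr_cyc (hc : ∀ r p q, c r p q = - c r q p) (ha : ∀ m n', a m n' = a n' m)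
    (hinv : ∀ p m n', ∑ s, (c s p m * a s n' + c s p n' * a m s) = 0)
    (u v w : Fin N → Rg N) : fr a u (br c v w) = fr a v (br c w u) := by
  have h := fr_br c a hinv w u v
  rw [fr_symm a ha v, h, br_anti c hc v w]
  simp [fr]

lemma br_br (n : Fin N) (u v w : Fin N → Rg N) : br c u (br c v w) n =
    ∑ p, ∑ s, ∑ t, C (∑ r, c n p r * c r s t) * (u p * v s * w t) := by
  simp only [br, Finset.sum_mul, Finset.mul_sum, map_sum]
  calc _ = ∑ p, ∑ s, ∑ r, ∑ t, C (c n p r) * (u p * (C (c r s t) * (v s * w t))) := by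
            exact Finset.sum_congr rfl fun s _ => Finset.sum_comm
      _ = ∑ p, ∑ s, ∑ t, ∑ r, C (c n p r) * (u p * (C (c r s t) * (v s * w t))) := by
            exact Finset.sum_congr rfl fun p _ => Finset.sum_congr rfl fun s _ => Finset.sum_comm
      _ = _ := by
            refine Finset.sum_congr rfl fun p _ => Finset.sum_congr rfl fun m _ =>
              Finset.sum_congr rfl fun n _ => Finset.sum_congr rfl fun s _ => ?_
            rw [C_mul]; ring

lemma jac (hc : ∀ r p q, c r p q = - c r q p)
    (hJacobi : ∀ p q t r,
      ∑ s, (c s p q * c r s t + c s q t * c r s p + c s t p * c r s q) = 0)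
    (u v w : Fin N → Rg N) :
    br c u (br c v w) + br c v (br c w u) + br c w (br c u v) = 0 := by
  ext1 n
  have h2 : br c v (br c w u) n =
      ∑ p, ∑ s, ∑ t, C (∑ r, c n s r * c r t p) * (u p * v s * w t) := by
    rw [br_br]
    calc _ = ∑ s, ∑ p, ∑ t, C (∑ r, c n s r * c r t p) * (v s * w t * u p) := by
            exact Finset.sum_congr rfl fun s _ => Finset.sum_comm
      _ = ∑ p, ∑ s, ∑ t, C (∑ r, c n s r * c r t p) * (v s * w t * u p) := Finset.sum_comm
      _ = _ := by
            refine Finset.sum_congr rfl fun p _ => Finset.sum_congr rfl fun m _ =>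
              Finset.sum_congr rfl fun n _ => ?_
            ring
  have h3 : br c w (br c u v) n =
      ∑ p, ∑ s, ∑ t, C (∑ r, c n t r * c r p s) * (u p * v s * w t) := by
    rw [br_br]
    calc _ = ∑ p, ∑ t, ∑ s, C (∑ r, c n t r * c r p s) * (w t * u p * v s) := Finset.sum_comm
      _ = ∑ p, ∑ s, ∑ t, C (∑ r, c n t r * c r p s) * (w t * u p * v s) := by
            exact Finset.sum_congr rfl fun s _ => Finset.sum_comm
      _ = _ := by
            refine Finset.sum_congr rfl fun p _ => Finset.sum_congr rfl fun m _ =>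
              Finset.sum_congr rfl fun n _ => ?_
            ring
  simp only [Pi.add_apply, Pi.zero_apply]
  rw [br_br, h2, h3]
  simp only [← Finset.sum_add_distrib, ← add_mul, ← C_add]
  refine Finset.sum_eq_zero fun p _ => Finset.sum_eq_zero fun s _ => Finset.sum_eq_zero fun t _ => ?_
  have : (∑ r, (c n p r * c r s t + c n s r * c r t p + c n t r * c r p s)) = 0 := by
    rw [← neg_eq_zero, ← Finset.sum_neg_distrib, ← hJacobi p s t n]
    refine Finset.sum_congr rfl fun r _ => ?_
    rw [hc n p r, hc n s r, hc n t r]; ring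
  rw [this]; simp

/-- The gauge potential as a vector. -/
noncomputable def A (N : ℕ) (l : Fin 3) : Fin N → Rg N := fun r => aVar N r l

noncomputable abbrev d (N : ℕ) (l : Fin 3) := totalDeriv ℝ (n := 3) (Fin N × Fin 3) l

lemma LCS_eq : LCS N c a = ∑ α, ∑ β, ∑ γ, C (eps α β γ) *
    (fr a (A N α) (dv (d N γ) (A N β)) - C (1/3) * fr a (A N α) (br c (A N β) (A N γ))) := by
  have h1 : (∑ m, ∑ n', ∑ α, ∑ β, ∑ γ, MvPolynomial.C (a m n' * eps α β γ) *
      (aVar N m α * totalDeriv ℝ (Fin N × Fin 3) γ (aVar N n' β))) =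
      ∑ α, ∑ β, ∑ γ, C (eps α β γ) * fr a (A N α) (dv (d N γ) (A N β)) := by
    simp only [fr, dv, A, d, Fin.sum_univ_three, Finset.mul_sum, ← Finset.sum_add_distrib, C_mul]
    refine Finset.sum_congr rfl fun p _ => Finset.sum_congr rfl fun m _ => ?_
    ring
  have h2 : (∑ m, ∑ n', ∑ p, ∑ q, ∑ α, ∑ β, ∑ γ,
          MvPolynomial.C (eps α β γ * a m n' * c n' p q) *
            (aVar N m α * aVar N p β * aVar N q γ)) =
      ∑ α, ∑ β, ∑ γ, C (eps α β γ) * fr a (A N α) (br c (A N β) (A N γ)) := by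
    simp only [fr, br, A, Fin.sum_univ_three, Finset.mul_sum, ← Finset.sum_add_distrib, C_mul]
    refine Finset.sum_congr rfl fun p _ => Finset.sum_congr rfl fun m _ =>
      Finset.sum_congr rfl fun _ _ => Finset.sum_congr rfl fun _ _ => ?_
    ring
  rw [LCS, h1, h2]
  rw [Finset.mul_sum, ← Finset.sum_sub_distrib]
  refine Finset.sum_congr rfl fun p _ => ?_
  rw [Finset.mul_sum, ← Finset.sum_sub_distrib]
  refine Finset.sum_congr rfl fun p _ => ?_
  rw [Finset.mul_sum, ← Finset.sum_sub_distrib]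
  refine Finset.sum_congr rfl fun p _ => ?_
  ring

lemma eps_sum {M : Type*} [AddCommGroup M] [Module (Rg N) M] (f : Fin 3 → Fin 3 → Fin 3 → M) :
    ∑ α, ∑ β, ∑ γ, (C (eps α β γ) : Rg N) • f α β γ =
    f 0 1 2 + f 1 2 0 + f 2 0 1 - f 0 2 1 - f 2 1 0 - f 1 0 2 := by
  simp [Fin.sum_univ_three, eps]
  abel

/-- Derivations of the Lagrangian. -/
lemma D_LCS (hc : ∀ r p q, c r p q = - c r q p) (ha : ∀ m n', a m n' = a n' m)
    (hinv : ∀ p m n', ∑ s, (c s p m * a s n' + c s p n' * a m s) = 0)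
    (D : Derivation ℝ (Rg N) (Rg N)) : D (LCS N c a) = ∑ α, ∑ β, ∑ γ, (C (eps α β γ) : Rg N) •
    (fr a (dv D (A N α)) (dv (d N γ) (A N β)) + fr a (A N α) (dv D (dv (d N γ) (A N β)))
      - fr a (dv D (A N α)) (br c (A N β) (A N γ))) := by
  have key : ∀ α β γ, D (fr a (A N α) (br c (A N β) (A N γ))) =
      fr a (dv D (A N α)) (br c (A N β) (A N γ)) + fr a (dv D (A N β)) (br c (A N γ) (A N α))
       + fr a (dv D (A N γ)) (br c (A N α) (A N β)) := by
    intro α β γ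
    rw [D_fr, dv_br, fr_add_right, fr_cyc c a hc ha hinv _ (dv D (A N β)),
      fr_cyc c a hc ha hinv (A N α) (A N β) (dv D (A N γ)),
      fr_cyc c a hc ha hinv (A N β) (dv D (A N γ)), add_assoc]
  rw [LCS_eq]
  simp only [map_sum, D_C_mul, map_sub, key, D_fr]
  simp only [← smul_eq_mul (C (eps _ _ _)), eps_sum]
  have h3 : (C (1/3:ℝ) : Rg N) * 3 = 1 := by
    rw [show (3 : Rg N) = C 3 from (map_ofNat C 3).symm, ← C_mul]; norm_num
  linear_combination (-(fr a (dv D (A N 0)) (br c (A N 1) (A N 2))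
    + fr a (dv D (A N 1)) (br c (A N 2) (A N 0)) + fr a (dv D (A N 2)) (br c (A N 0) (A N 1))
    - fr a (dv D (A N 0)) (br c (A N 2) (A N 1)) - fr a (dv D (A N 2)) (br c (A N 1) (A N 0))
    - fr a (dv D (A N 1)) (br c (A N 0) (A N 2)))) * h3

lemma d_X (l : Fin 3) (i : Fin N × Fin 3) (Λ : Fin 3 →₀ ℕ) :
    d N l (X (i, Λ)) = X (i, Λ + Finsupp.single l 1) := by
  simp [d, totalDeriv]

/-- Basis vector. -/
noncomputable def e (q : Fin N) : Fin N → Rg N := Pi.single q 1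

lemma pd_A (q : Fin N) (l α : Fin 3) (Λ : Fin 3 →₀ ℕ) :
    dv (pderiv ((q, l), Λ)) (A N α) = if α = l ∧ Λ = 0 then e q else 0 := by
  ext1 r
  simp only [dv, A, aVar, pderiv_X, e, Pi.single_apply, Prod.mk.injEq]
  split_ifs <;> simp_all

lemma pd_dA (q : Fin N) (l β γ : Fin 3) (Λ : Fin 3 →₀ ℕ) :
    dv (pderiv ((q, l), Λ)) (dv (d N γ) (A N β)) =
      if β = l ∧ Λ = Finsupp.single γ 1 then e q else 0 := by
  ext1 r
  simp only [dv, A, aVar, d_X, zero_add, pderiv_X, e, Pi.single_apply, Prod.mk.injEq]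
  split_ifs <;> simp_all

lemma dIter_zero (f : Rg N) : dIter (fun l => ⇑(d N l)) 0 f = f := by
  simp [dIter, List.finRange_succ]

lemma dIter_single (γ : Fin 3) (f : Rg N) :
    dIter (fun l => ⇑(d N l)) (Finsupp.single γ 1) f = d N γ f := by
  fin_cases γ <;> simp [dIter, List.finRange_succ]

/-- Field strength. -/
noncomputable def F (β γ : Fin 3) : Fin N → Rg N :=
  dv (d N β) (A N γ) - dv (d N γ) (A N β) + br c (A N β) (A N γ)

lemma single_ne (γ δ : Fin 3) : Finsupp.single γ 1 = Finsupp.single δ 1 ↔ γ = δ :=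
  Finsupp.single_left_inj one_ne_zero

lemma pd_zero (hc : ∀ r p q, c r p q = - c r q p) (ha : ∀ m n', a m n' = a n' m)
    (hinv : ∀ p m n', ∑ s, (c s p m * a s n' + c s p n' * a m s) = 0) (q : Fin N) (l : Fin 3)
    (Λ : Fin 3 →₀ ℕ) (h0 : Λ ≠ 0) (h1 : ∀ γ, Λ ≠ Finsupp.single γ 1) :
    pderiv ((q, l), Λ) (LCS N c a) = 0 := by
  simp [D_LCS c a hc ha hinv, pd_A, pd_dA, h0, h1, fr_zero_left, fr_zero_right]

lemma ELCS_raw (hc : ∀ r p q, c r p q = - c r q p) (ha : ∀ m n', a m n' = a n' m)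
    (hinv : ∀ p m n', ∑ s, (c s p m * a s n' + c s p n' * a m s) = 0)
    (q : Fin N) (l : Fin 3) : ELCS N c a q l =
    pderiv ((q, l), 0) (LCS N c a)
      - ∑ γ, d N γ (pderiv ((q, l), Finsupp.single γ 1) (LCS N c a)) := by
  classical
  have hz : ∀ Λ, dIter (fun l => ⇑(d N l)) Λ 0 = 0 := by
    intro Λ
    have hit : ∀ (i : Fin 3) (k : ℕ), (⇑(d N i))^[k] 0 = 0 := fun i k =>
      Function.iterate_fixed (map_zero _) k
    simp [dIter, List.finRange_succ, hit]
  have hinj : Function.Injective (fun γ : Fin 3 => (Finsupp.single γ 1 : Fin 3 →₀ ℕ)) :=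
    fun x y h => (single_ne x y).1 h
  rw [ELCS, EL, finsum_eq_sum_of_support_subset (s := insert 0
    (Finset.univ.image fun γ : Fin 3 => (Finsupp.single γ 1 : Fin 3 →₀ ℕ)))]
  · rw [Finset.sum_insert (by simp), Finset.sum_image (fun x _ y _ h => hinj h),
      sub_eq_add_neg, ← Finset.sum_neg_distrib]
    congr 1
    · rw [dIter_zero]; simp [msize]
    · refine Finset.sum_congr rfl fun γ _ => ?_
      rw [dIter_single]; simp [msize]
  · intro Λ hΛ
    by_contra hcon
    simp only [Finset.coe_insert, Finset.coe_image, Set.mem_insert_iff, not_or] at hcon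
    apply hΛ
    simp only
    rw [pd_zero c a hc ha hinv q l Λ hcon.1 (fun γ h => hcon.2 ⟨γ, by simp, h.symm⟩), hz, mul_zero]

lemma dv_zero (D : Derivation ℝ (Rg N) (Rg N)) : dv D (0 : Fin N → Rg N) = 0 := by
  ext1 r; simp [dv]

lemma dv_e (D : Derivation ℝ (Rg N) (Rg N)) (q : Fin N) : dv D (e q) = 0 := by
  ext1 r
  simp only [dv, e, Pi.single_apply]
  split_ifs <;> simp

lemma ELCS_eq (hc : ∀ r p q, c r p q = - c r q p) (ha : ∀ m n', a m n' = a n' m)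
    (hinv : ∀ p m n', ∑ s, (c s p m * a s n' + c s p n' * a m s) = 0) (q : Fin N) (l : Fin 3) :
    ELCS N c a q l = - ∑ β, ∑ γ, (C (eps l β γ) : Rg N) * fr a (e q) (F c β γ) := by
  rw [ELCS_raw c a hc ha hinv]
  simp only [D_LCS c a hc ha hinv, pd_A, pd_dA, eps_sum, F, single_ne,
    Finsupp.single_eq_zero, one_ne_zero, and_false, if_false, fr_zero_left, and_true,
    fr_add_right, fr_sub_right, (Finsupp.single_ne_zero.2 one_ne_zero).symm]
  fin_cases l <;> simp [Fin.sum_univ_three, eps, fr_zero_left, fr_zero_right, D_fr, dv_e, dv_zero] <;>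
    simp only [fr_symm a ha _ (e q)] <;> ring

lemma d_comm (l β α : Fin 3) : dv (d N l) (dv (d N β) (A N α)) = dv (d N β) (dv (d N l) (A N α)) := by
  ext1 r
  simp only [dv, A, aVar, d_X]
  rw [add_right_comm]

lemma bianchi (hc : ∀ r p q, c r p q = - c r q p)
    (hJacobi : ∀ p q t r,
      ∑ s, (c s p q * c r s t + c s q t * c r s p + c s t p * c r s q) = 0) :
    ∑ α, ∑ β, ∑ γ, (C (eps α β γ) : Rg N) • (dv (d N α) (F c β γ) + br c (A N α) (F c β γ)) = 0 := by
  have hJ := jac c hc hJacobi (A N 0) (A N 1) (A N 2)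
  have hJ' := jac c hc hJacobi (A N 0) (A N 2) (A N 1)
  rw [eps_sum]
  simp only [F, dv_add, dv_sub, dv_br, br_add_right, br_sub_right,
    d_comm 1 0, d_comm 2 0, d_comm 2 1]
  have hA : ∀ i j k, br c (dv (d N i) (A N j)) (A N k) = - br c (A N k) (dv (d N i) (A N j)) :=
    fun i j k => br_anti c hc _ _
  simp only [hA]
  linear_combination hJ - hJ'

lemma br_e (q : Fin N) (u : Fin N → Rg N) (r : Fin N) :
    br c u (e q) r = ∑ p, C (c r p q) * u p := by
  simp [br, e, Pi.single_apply]

lemma fr_e (q : Fin N) (u : Fin N → Rg N) :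
    fr a (e q) u = ∑ n, C (a q n) * u n := by
  simp [fr, e, Pi.single_apply]

lemma fr_expand (u v : Fin N → Rg N) : fr a u v = ∑ r, u r * fr a (e r) v := by
  simp only [fr_e]
  simp only [fr, Finset.mul_sum]
  refine Finset.sum_congr rfl fun p _ => Finset.sum_congr rfl fun m _ => ?_
  ring

end CSaux

/-- Noether identity for the local Chern–Simons Lagrangian (identity (gr1)):
`∑_{r,p,λ} c^r_{pq} a^p_λ E^λ_r - ∑_λ d_λ (E^λ_q) = 0`. -/
theorem chern_simons_noether_identity (N : ℕ) (hN : 1 ≤ N)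
    (c : Fin N → Fin N → Fin N → ℝ)
    (hc : ∀ r p q, c r p q = - c r q p)
    (hJacobi : ∀ p q t r,
      ∑ s, (c s p q * c r s t + c s q t * c r s p + c s t p * c r s q) = 0)
    (a : Fin N → Fin N → ℝ) (ha : ∀ m n', a m n' = a n' m)
    (hinv : ∀ p m n', ∑ s, (c s p m * a s n' + c s p n' * a m s) = 0)
    (q : Fin N) :
    (∑ r, ∑ p, ∑ l, MvPolynomial.C (c r p q) * aVar N p l * ELCS N c a r l)
      - ∑ l, totalDeriv ℝ (Fin N × Fin 3) l (ELCS N c a q l) = 0 := by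
  have hE := CSaux.ELCS_eq c a hc ha hinv
  have h1 : (∑ r, ∑ p, ∑ l, MvPolynomial.C (c r p q) * aVar N p l * ELCS N c a r l) =
      ∑ l, ∑ β, ∑ γ, (MvPolynomial.C (eps l β γ) : CSaux.Rg N) •
        CSaux.fr a (CSaux.e q) (CSaux.br c (CSaux.A N l) (CSaux.F c β γ)) := by
    calc _ = ∑ l, ∑ r, CSaux.br c (CSaux.A N l) (CSaux.e q) r * ELCS N c a r l := by
          simp only [CSaux.br_e, Finset.sum_mul, CSaux.A]
          rw [Finset.sum_comm]
          rw [Finset.sum_comm, Finset.sum_comm (s := (Finset.univ : Finset (Fin 3)))]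
          exact Finset.sum_congr rfl fun r _ => Finset.sum_comm
      _ = ∑ l, ∑ β, ∑ γ, MvPolynomial.C (eps l β γ) *
          (- CSaux.fr a (CSaux.br c (CSaux.A N l) (CSaux.e q)) (CSaux.F c β γ)) := by
          refine Finset.sum_congr rfl fun l _ => ?_
          simp only [hE, CSaux.fr_expand a (CSaux.br _ _ _), Fin.sum_univ_three, Finset.mul_sum,
            ← Finset.sum_neg_distrib, ← Finset.sum_add_distrib]
          refine Finset.sum_congr rfl fun r _ => ?_
          ring
      _ = _ := by
          simp only [CSaux.fr_br c a hinv, neg_neg, smul_eq_mul]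
  have h2 : ∑ l, totalDeriv ℝ (Fin N × Fin 3) l (ELCS N c a q l) =
      - ∑ l, ∑ β, ∑ γ, (MvPolynomial.C (eps l β γ) : CSaux.Rg N) •
        CSaux.fr a (CSaux.e q) (CSaux.dv (CSaux.d N l) (CSaux.F c β γ)) := by
    simp only [hE, map_neg, map_sum, CSaux.D_C_mul, CSaux.D_fr, CSaux.dv_e, CSaux.fr_zero_left,
      zero_add, Finset.sum_neg_distrib, smul_eq_mul]
  have hB := congrArg (CSaux.fr a (CSaux.e q)) (CSaux.bianchi c hc hJacobi)
  rw [CSaux.eps_sum] at hB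
  simp only [CSaux.fr_add_right, CSaux.fr_sub_right, CSaux.fr_zero_right] at hB
  rw [h1, h2, CSaux.eps_sum, CSaux.eps_sum]
  linear_combination hB
end
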